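/- arXiv:1905.06093 — 3 statements merged into one kernel-verified Lean document; each statement's English description precedes it below -/
import Mathlib

section
/- Let k ≥ 2 and let T be the k-regular tree with vertex set V and automorphism group Aut(T). Let A be a finite alphabet, 0 ∈ A, and let f : A^V → A^V be a cellular automaton on the action Aut(T) ↷ V (i.e. f is continuous and commutes with the action of every graph automorphism on configurations). If f is asymptotically nilpotent toward the constant configuration 0^V, then f is nilpotent: there exists n ∈ ℕ such that f^n(x) = 0^V for every x ∈ A^V. -/
open Filter

namespace TreeCA

def AN {V A : Type*} (f : (V → A) → (V → A)) (z : A) : Prop :=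
  ∀ x v, ∃ n, ∀ m ≥ n, f^[m] x v = z

def Loc {V A : Type*} (d : V → V → ℕ) (r : ℕ) (f : (V → A) → (V → A)) : Prop :=
  ∀ v x y, (∀ w, d v w ≤ r → x w = y w) → f x v = f y v

theorem AN.finite {V A : Type*} {f : (V → A) → (V → A)} {z : A} (h : AN f z) (x : V → A)
    {B : Set V} (hB : B.Finite) : ∃ n, ∀ m ≥ n, ∀ v ∈ B, f^[m] x v = z := by
  choose n hn using h x
  obtain ⟨N, hN⟩ := (hB.image n).bddAbove
  exact ⟨N, fun m hm v hv => hn v m (le_trans (hN ⟨v, hv, rfl⟩) hm)⟩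

theorem Loc.iter {V A : Type*} {d : V → V → ℕ} {r : ℕ} {f : (V → A) → (V → A)}
    (hd : ∀ a, d a a = 0) (ht : ∀ a b c, d a c ≤ d a b + d b c)
    (h : Loc d r f) (n : ℕ) : Loc d (r * n) (f^[n]) := by
  induction n with
  | zero =>
    intro v x y hxy
    exact hxy v (by simp [hd])
  | succ n ih =>
    intro v x y hxy
    rw [Function.iterate_succ_apply, Function.iterate_succ_apply]
    apply ih
    intro w hw
    apply h
    intro w' hw'
    apply hxy
    have := ht v w w'
    rw [Nat.mul_succ]
    omega

theorem fix_z {V A : Type*} {d : V → V → ℕ} {r : ℕ} {f : (V → A) → (V → A)} {z : A}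
    (hfin : ∀ v n, {w | d v w ≤ n}.Finite)
    (h : Loc d r f) (hn : AN f z) : f (fun _ => z) = fun _ => z := by
  funext v
  obtain ⟨n, hn1⟩ := hn.finite (fun _ => z) (hfin v r)
  obtain ⟨n2, hn2⟩ := hn (fun _ => z) v
  have h1 := hn2 (max n n2 + 1) (by omega)
  rw [Function.iterate_succ_apply'] at h1
  refine Eq.trans ?_ h1
  apply h
  intro w hw
  exact (hn1 (max n n2) (le_max_left _ _) w hw).symm

theorem iter_fix {V A : Type*} {f : (V → A) → (V → A)} {z : A}
    (h : f (fun _ => z) = fun _ => z) (n : ℕ) : f^[n] (fun _ => z) = fun _ => z :=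
  Function.iterate_fixed h n

theorem mortal_mono {V A : Type*} {f : (V → A) → (V → A)} {z : A}
    (h : f (fun _ => z) = fun _ => z) {x : V → A} {n m : ℕ} (hnm : n ≤ m)
    (hx : f^[n] x = fun _ => z) : f^[m] x = fun _ => z := by
  obtain ⟨k, rfl⟩ := Nat.exists_eq_add_of_le hnm
  rw [Nat.add_comm, Function.iterate_add_apply, hx, iter_fix h]

theorem iter_comm {V A : Type*} {f : (V → A) → (V → A)} {g : Equiv.Perm V}
    (hgf : ∀ x : V → A, f (fun t => x (g.symm t)) = fun t => f x (g.symm t)) :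
    ∀ n, ∀ x : V → A, f^[n] (fun t => x (g.symm t)) = fun t => f^[n] x (g.symm t) := by
  intro n
  induction n with
  | zero => intro x; rfl
  | succ n ih =>
    intro x
    rw [Function.iterate_succ_apply, hgf, ih]
    rfl

/-- Baire. -/
theorem baire {V A : Type*} [Finite A] [TopologicalSpace A] [DiscreteTopology A]
    {f : (V → A) → (V → A)} {z : A} (hf : Continuous f) (hn : AN f z)
    (D : Set (V → A)) (hD : D.Nonempty) {B : Set V} (hB : B.Finite) :
    ∃ p ∈ D, ∃ S : Set V, S.Finite ∧ ∃ t, ∀ x ∈ D, (∀ w ∈ S, x w = p w) →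
      ∀ n ≥ t, ∀ v ∈ B, f^[n] x v = z := by
  let M := closure D
  have hMc : IsClosed M := isClosed_closure
  have : CompactSpace M := isCompact_iff_compactSpace.mp hMc.isCompact
  have : Nonempty M := hD.closure.to_subtype
  let U : ℕ → Set M := fun t => {x | ∀ n ≥ t, ∀ v ∈ B, f^[n] x.1 v = z}
  have hUc : ∀ t, IsClosed (U t) := by
    intro t
    have : U t = ⋂ n, ⋂ (_ : n ≥ t), ⋂ v, ⋂ (_ : v ∈ B), {x : M | f^[n] x.1 v = z} := by
      ext x; simp [U]
    rw [this]
    refine isClosed_iInter fun n => isClosed_iInter fun _ => isClosed_iInter fun v =>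
      isClosed_iInter fun _ => ?_
    apply isClosed_eq _ continuous_const
    exact (continuous_apply v).comp ((hf.iterate n).comp continuous_subtype_val)
  have hUu : ⋃ t, U t = Set.univ := by
    ext x
    simp only [Set.mem_iUnion, Set.mem_univ, iff_true]
    exact hn.finite x.1 hB
  obtain ⟨t, ⟨q, hq⟩⟩ := nonempty_interior_of_iUnion_of_closed hUc hUu
  have hq' : U t ∈ nhds q := mem_interior_iff_mem_nhds.mp hq
  rw [nhds_subtype_eq_comap, mem_comap] at hq'
  obtain ⟨W, hW, hWU⟩ := hq'
  rw [nhds_pi, Filter.mem_pi] at hW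
  obtain ⟨S, hS, Wi, hWi, hWS⟩ := hW
  -- the cylinder
  have hcyl : ∀ x ∈ M, (∀ w ∈ S, x w = q.1 w) → ∀ n ≥ t, ∀ v ∈ B, f^[n] x v = z := by
    intro x hx hxq
    have : (⟨x, hx⟩ : M) ∈ U t := by
      apply hWU
      apply hWS
      intro w hw
      change x w ∈ Wi w
      rw [hxq w hw]
      exact mem_of_mem_nhds (hWi w)
    exact this
  have hopen : IsOpen {x : V → A | ∀ w ∈ S, x w = q.1 w} := by
    have : {x : V → A | ∀ w ∈ S, x w = q.1 w} = S.pi (fun w => {q.1 w}) := by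
      ext x; simp [Set.mem_pi]
    rw [this]
    exact isOpen_set_pi hS (fun w _ => isOpen_discrete _)
  obtain ⟨p, hp1, hp2⟩ := mem_closure_iff.mp q.2 _ hopen (fun w _ => rfl)
  refine ⟨p, hp2, S, hS, t, fun x hx hxp => hcyl x (subset_closure hx) ?_⟩
  intro w hw
  rw [hxp w hw, hp1 w hw]

/-- Compactness windows. -/
theorem windows {V A : Type*} [Finite A] [TopologicalSpace A] [DiscreteTopology A]
    {f : (V → A) → (V → A)} {z : A} (hf : Continuous f) (hn : AN f z)
    {B : Set V} (hB : B.Finite) (T : ℕ) :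
    ∃ N, ∀ x, ∃ n ≤ N, (∀ v ∈ B, f^[n] x v = z) ∧ (∀ v ∈ B, f^[n + T] x v = z) := by
  let U : ℕ → Set (V → A) :=
    fun n => {x | (∀ v ∈ B, f^[n] x v = z) ∧ (∀ v ∈ B, f^[n + T] x v = z)}
  have hUo : ∀ n, IsOpen (U n) := by
    have key : ∀ n, IsOpen {x : V → A | ∀ v ∈ B, f^[n] x v = z} := by
      intro n
      have : {x : V → A | ∀ v ∈ B, f^[n] x v = z} = (f^[n]) ⁻¹' (B.pi (fun _ => {z})) := by
        ext x; simp [Set.mem_pi]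
      rw [this]
      exact (isOpen_set_pi hB (fun w _ => isOpen_discrete _)).preimage (hf.iterate n)
    intro n
    exact (key n).inter (key (n + T))
  have hcov : (Set.univ : Set (V → A)) ⊆ ⋃ n, U n := by
    intro x _
    obtain ⟨n, h⟩ := hn.finite x hB
    exact Set.mem_iUnion.mpr ⟨n, h n le_rfl, h _ (by omega)⟩
  obtain ⟨s, hs⟩ := isCompact_univ.elim_finite_subcover U hUo hcov
  refine ⟨s.sup id, fun x => ?_⟩
  have := hs (Set.mem_univ x)
  simp only [Set.mem_iUnion] at this
  obtain ⟨n, hns, h⟩ := this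
  exact ⟨n, Finset.le_sup (f := id) hns, h⟩

/-- Gluing. -/
theorem glue {V A : Type*} {d : V → V → ℕ} {r : ℕ} {f : (V → A) → (V → A)} {z : A}
    (hd : ∀ a, d a a = 0) (hs : ∀ a b, d a b = d b a) (ht : ∀ a b c, d a c ≤ d a b + d b c)
    (h : Loc d r f) {p y : V → A} {o : V} {K T m : ℕ}
    (hm : K + 2 * (r * T) ≤ m)
    (hp : ∀ w, K < d o w → p w = z) (hpm : f^[T] p = fun _ => z)
    (hy0 : ∀ w, d o w ≤ m → y w = z) (hyT : ∀ w, d o w ≤ m → f^[T] y w = z) :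
    f^[T] (fun w => open Classical in if d o w ≤ K then p w else y w) = f^[T] y := by
  classical
  funext w
  have hl := h.iter hd ht T
  by_cases hw : d o w ≤ K + r * T
  · rw [hyT w (by omega)]
    have : f^[T] p w = z := by rw [hpm]
    rw [← this]
    apply hl
    intro w' hw'
    have := ht o w w'
    split_ifs with h1
    · rfl
    · rw [hp w' (by omega), hy0 w' (by omega)]
  · apply hl
    intro w' hw'
    have h2 := ht o w' w
    rw [hs w' w] at h2
    rw [if_neg (by omega)]

/-- Step 2. -/
theorem stepC {V A : Type*} [Finite A] [TopologicalSpace A] [DiscreteTopology A]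
    {d : V → V → ℕ} {r : ℕ} {f : (V → A) → (V → A)} {z : A}
    (hd : ∀ a, d a a = 0) (hs : ∀ a b, d a b = d b a) (ht : ∀ a b c, d a c ≤ d a b + d b c)
    (hfin : ∀ v n, {w | d v w ≤ n}.Finite)
    (hf : Continuous f) (h : Loc d r f) (hn : AN f z)
    (htrans : ∀ u v : V, ∃ g : Equiv.Perm V, g u = v ∧
      ∀ x : V → A, f (fun t => x (g.symm t)) = fun t => f x (g.symm t))
    {o : V} {p : V → A} {S : Set V} (hS : S.Finite) {t T : ℕ}
    (hpf : {w | p w ≠ z}.Finite) (hpm : f^[T] p = fun _ => z)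
    (hw : ∀ x : V → A, (∀ w ∈ S, x w = p w) → ∀ n ≥ t, f^[n] x o = z) :
    ∃ n : ℕ, ∀ x : V → A, f^[n] x = fun _ => z := by
  classical
  by_contra hcon
  push Not at hcon
  have hz := fix_z hfin h hn
  obtain ⟨K, hK⟩ := ((hS.union hpf).image (d o)).bddAbove
  have hK1 : ∀ w ∈ S, d o w ≤ K := fun w hw => hK ⟨w, Or.inl hw, rfl⟩
  have hK2 : ∀ w, K < d o w → p w = z := by
    intro w hw
    by_contra hne
    have := hK ⟨w, Or.inr hne, rfl⟩
    omega
  let T' := max t T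
  have hpm' : f^[T'] p = fun _ => z := mortal_mono hz (le_max_right _ _) hpm
  let m := K + 2 * (r * T')
  obtain ⟨N, hN⟩ := windows hf hn (hfin o m) T'
  obtain ⟨x, hx⟩ := hcon (N + T')
  obtain ⟨v, hv⟩ := Function.ne_iff.mp hx
  obtain ⟨g, hg, hgf⟩ := htrans v o
  have hgi := iter_comm (g := g) hgf
  let x1 : V → A := fun t => x (g.symm t)
  have hx1 : f^[N + T'] x1 o ≠ z := by
    have : g.symm o = v := by rw [← hg]; simp
    simp only [x1]
    rw [hgi]
    change f^[N + T'] x (g.symm o) ≠ z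
    rw [this]
    exact hv
  obtain ⟨n, hnN, h0, hT⟩ := hN x1
  let y := f^[n] x1
  have hyT : ∀ w, d o w ≤ m → f^[T'] y w = z := by
    intro w hw
    have := hT w hw
    rw [Nat.add_comm, Function.iterate_add_apply] at this
    exact this
  have hG := glue hd hs ht h (le_refl m) hK2 hpm' h0 hyT
  set x' : V → A := (fun w => if d o w ≤ K then p w else y w) with hx'
  have h3 : f^[(N - n) + T'] x' o = z := by
    apply hw
    · intro w hw
      simp only [hx']
      rw [if_pos (hK1 w hw)]
    · have : t ≤ T' := le_max_left _ _
      omega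
  apply hx1
  have : N + T' = (N - n) + T' + n := by omega
  rw [this, Function.iterate_add_apply _ _ n]
  rw [Function.iterate_add_apply] at h3 ⊢
  rw [← h3]
  have : f^[T'] x' = f^[T'] y := by
    convert hG
  rw [this]

theorem stepE {V A : Type*} [Finite A] [TopologicalSpace A] [DiscreteTopology A]
    {d : V → V → ℕ} {r : ℕ} {f : (V → A) → (V → A)} {z : A}
    (hd : ∀ a, d a a = 0) (hs : ∀ a b, d a b = d b a) (ht : ∀ a b c, d a c ≤ d a b + d b c)
    (hfin : ∀ v n, {w | d v w ≤ n}.Finite)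
    (hf : Continuous f) (h : Loc d r f) (hn : AN f z) (o : V)
    (hlate : ∀ m T t : ℕ, ∃ y : V → A, {w | y w ≠ z}.Finite ∧ (∃ n, f^[n] y = fun _ => z) ∧
      (∀ w, d o w ≤ m → y w = z) ∧ (∀ w, d o w ≤ m → f^[T] y w = z) ∧
      ∃ s ≥ t, f^[s] y o ≠ z) : False := by
  classical
  have hz := fix_z hfin h hn
  let D : Set (V → A) := {y | {w | y w ≠ z}.Finite ∧ (∃ n, f^[n] y = fun _ => z)}
  have hD : D.Nonempty := ⟨fun _ => z, by simp, 0, rfl⟩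
  obtain ⟨p, ⟨hpf, T, hpm⟩, S, hS, t, hw⟩ := baire hf hn D hD (Set.finite_singleton o)
  obtain ⟨K, hK⟩ := ((hS.union hpf).image (d o)).bddAbove
  have hK1 : ∀ w ∈ S, d o w ≤ K := fun w hw => hK ⟨w, Or.inl hw, rfl⟩
  have hK2 : ∀ w, K < d o w → p w = z := by
    intro w hw
    by_contra hne
    have := hK ⟨w, Or.inr hne, rfl⟩
    omega
  obtain ⟨y, hyf, ⟨n, hyn⟩, hy0, hyT, s, hst, hys⟩ := hlate (K + 2 * (r * T)) T (max t T)
  have hG := glue hd hs ht h le_rfl hK2 hpm hy0 hyT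
  set x' : V → A := (fun w => if d o w ≤ K then p w else y w) with hx'
  have hG' : f^[T] x' = f^[T] y := by convert hG
  have hG2 : ∀ j, T ≤ j → f^[j] x' = f^[j] y := by
    intro j hj
    obtain ⟨k, rfl⟩ := Nat.exists_eq_add_of_le hj
    rw [Nat.add_comm, Function.iterate_add_apply, hG', ← Function.iterate_add_apply]
  apply hys
  rw [← hG2 s (le_trans (le_max_right _ _) hst)]
  refine hw x' ⟨?_, ?_⟩ ?_ s (le_trans (le_max_left _ _) hst) o rfl
  · refine (hpf.union hyf).subset ?_
    intro w hw
    simp only [hx', Set.mem_ofPred_eq] at hw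
    split_ifs at hw
    · exact Or.inl hw
    · exact Or.inr hw
  · refine ⟨max T n, ?_⟩
    rw [hG2 _ (le_max_left _ _)]
    exact mortal_mono hz (le_max_right _ _) hyn
  · intro w hw
    simp only [hx']
    rw [if_pos (hK1 w hw)]

theorem exists_radius {V A : Type*} [Finite A] [TopologicalSpace A] [DiscreteTopology A]
    {d : V → V → ℕ} {f : (V → A) → (V → A)} (hf : Continuous f) (o : V)
    (htrans : ∀ u v : V, ∃ g : Equiv.Perm V, g u = v ∧ (∀ a b, d (g a) (g b) = d a b) ∧
      ∀ x : V → A, f (fun t => x (g.symm t)) = fun t => f x (g.symm t)) :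
    ∃ r, Loc d r f := by
  classical
  have h1 : ∀ x : V → A, ∃ S : Set V, S.Finite ∧ ∀ y : V → A, (∀ w ∈ S, y w = x w) →
      f y o = f x o := by
    intro x
    have hop : IsOpen {y : V → A | f y o = f x o} := by
      have : {y : V → A | f y o = f x o} = (fun y => f y o) ⁻¹' {f x o} := by ext; simp
      rw [this]
      exact (isOpen_discrete _).preimage ((continuous_apply o).comp hf)
    have hx : {y : V → A | f y o = f x o} ∈ nhds x := hop.mem_nhds rfl
    rw [nhds_pi, Filter.mem_pi] at hx
    obtain ⟨S, hS, Wi, hWi, hWS⟩ := hx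
    refine ⟨S, hS, fun y hy => ?_⟩
    have : y ∈ {y : V → A | f y o = f x o} := by
      apply hWS
      intro w hw
      rw [hy w hw]
      exact mem_of_mem_nhds (hWi w)
    exact this
  choose S hS hSf using h1
  let U : (V → A) → Set (V → A) := fun x => {y | ∀ w ∈ S x, y w = x w}
  have hUo : ∀ x, IsOpen (U x) := by
    intro x
    have : U x = (S x).pi (fun w => {x w}) := by
      ext y; simp [Set.mem_pi, U]
    rw [this]
    exact isOpen_set_pi (hS x) (fun w _ => isOpen_discrete _)
  obtain ⟨s, hs⟩ := isCompact_univ.elim_finite_subcover U hUo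
    (fun x _ => Set.mem_iUnion.mpr ⟨x, fun w _ => rfl⟩)
  have hfinS : (⋃ x ∈ s, S x).Finite := s.finite_toSet.biUnion (fun x _ => hS x)
  obtain ⟨r, hr⟩ := (hfinS.image (d o)).bddAbove
  refine ⟨r, ?_⟩
  have key : ∀ x y : V → A, (∀ w, d o w ≤ r → x w = y w) → f x o = f y o := by
    intro x y hxy
    have := hs (Set.mem_univ x)
    simp only [Set.mem_iUnion] at this
    obtain ⟨c, hc, hxc⟩ := this
    have hyc : ∀ w ∈ S c, y w = c w := by
      intro w hw
      rw [← hxy w, hxc w hw]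
      exact hr ⟨w, Set.mem_biUnion hc hw, rfl⟩
    rw [hSf c x hxc, hSf c y hyc]
  intro v x y hxy
  obtain ⟨g, hg, hgd, hgf⟩ := htrans v o
  have hgo : g.symm o = v := by rw [← hg]; simp
  have h2 := key (fun t => x (g.symm t)) (fun t => y (g.symm t)) (by
    intro w hw
    apply hxy
    rw [← hgd, hg]
    simpa using hw)
  rw [hgf, hgf] at h2
  simpa [hgo] using h2

def cutR {A : Type*} (z : A) (c : ℤ) (x : ℤ → A) : ℤ → A := fun i => if c ≤ i then x i else z
def cutL {A : Type*} (z : A) (c : ℤ) (x : ℤ → A) : ℤ → A := fun i => if i ≤ c then x i else z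

abbrev dZ : ℤ → ℤ → ℕ := fun i j => (i - j).natAbs

theorem wallR {A : Type*} {z : A} {F : (ℤ → A) → (ℤ → A)} {r : ℕ} (h : Loc dZ r F)
    (hz : F (fun _ => z) = fun _ => z) (c : ℤ) (x : ℤ → A)
    (hw : ∀ n i, (i - c).natAbs ≤ r → F^[n] x i = z) (n : ℕ) :
    F^[n] (cutR z c x) = cutR z c (F^[n] x) := by
  induction n with
  | zero => rfl
  | succ n ih =>
    rw [Function.iterate_succ_apply', Function.iterate_succ_apply', ih]
    funext i
    by_cases hi : c ≤ i
    · simp only [cutR, if_pos hi]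
      apply h
      intro w hw'
      simp only [cutR]
      split_ifs with h1
      · rfl
      · exact (hw n w (by simp only [dZ] at hw'; omega)).symm
    · simp only [cutR, if_neg hi]
      have : F (fun _ => z) i = z := by rw [hz]
      refine Eq.trans ?_ this
      apply h
      intro w hw'
      simp only [cutR]
      split_ifs with h1
      · exact (hw n w (by simp only [dZ] at hw'; omega))
      · rfl

theorem wallL {A : Type*} {z : A} {F : (ℤ → A) → (ℤ → A)} {r : ℕ} (h : Loc dZ r F)
    (hz : F (fun _ => z) = fun _ => z) (c : ℤ) (x : ℤ → A)
    (hw : ∀ n i, (i - c).natAbs ≤ r → F^[n] x i = z) (n : ℕ) :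
    F^[n] (cutL z c x) = cutL z c (F^[n] x) := by
  induction n with
  | zero => rfl
  | succ n ih =>
    rw [Function.iterate_succ_apply', Function.iterate_succ_apply', ih]
    funext i
    by_cases hi : i ≤ c
    · simp only [cutL, if_pos hi]
      apply h
      intro w hw'
      simp only [cutL]
      split_ifs with h1
      · rfl
      · exact (hw n w (by simp only [dZ] at hw'; omega)).symm
    · simp only [cutL, if_neg hi]
      have : F (fun _ => z) i = z := by rw [hz]
      refine Eq.trans ?_ this
      apply h
      intro w hw'
      simp only [cutL]
      split_ifs with h1
      · exact (hw n w (by simp only [dZ] at hw'; omega))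
      · rfl

theorem dZ_self (a : ℤ) : dZ a a = 0 := by simp [dZ]
theorem dZ_comm (a b : ℤ) : dZ a b = dZ b a := by simp only [dZ]; omega
theorem dZ_tri (a b c : ℤ) : dZ a c ≤ dZ a b + dZ b c := by simp only [dZ]; omega
theorem dZ_fin (v : ℤ) (n : ℕ) : {w | dZ v w ≤ n}.Finite := by
  refine (Set.finite_Icc (v - n) (v + n)).subset ?_
  intro w hw
  simp only [dZ, Set.mem_ofPred_eq] at hw
  simp only [Set.mem_Icc]
  omega

theorem suppZ {A : Type*} {z : A} {F : (ℤ → A) → (ℤ → A)} {r : ℕ} (h : Loc dZ r F)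
    (hz : F (fun _ => z) = fun _ => z) {K : ℕ} {x : ℤ → A}
    (hx : ∀ i : ℤ, K < i.natAbs → x i = z) (n : ℕ) (i : ℤ) (hi : K + r * n < i.natAbs) :
    F^[n] x i = z := by
  have h1 : F^[n] (fun _ => z) i = z := by rw [iter_fix hz]
  refine Eq.trans ?_ h1
  apply h.iter dZ_self dZ_tri n
  intro w hw
  apply hx
  simp only [dZ] at hw
  omega

theorem shift_iter {A : Type*} {F : (ℤ → A) → (ℤ → A)}
    (hsh : ∀ x c, F (fun i => x (i + c)) = fun i => F x (i + c)) (n : ℕ) (x : ℤ → A) (c : ℤ) :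
    F^[n] (fun i => x (i + c)) = fun i => F^[n] x (i + c) := by
  induction n generalizing x with
  | zero => rfl
  | succ n ih => rw [Function.iterate_succ_apply, hsh, ih]; rfl

/-- The box between two walls dies. -/
theorem box_mortal {A : Type*} {z : A} {F : (ℤ → A) → (ℤ → A)} {r : ℕ} (h : Loc dZ r F)
    (hz : F (fun _ => z) = fun _ => z) (hn : AN F z)
    (hsh : ∀ x c, F (fun i => x (i + c)) = fun i => F x (i + c))
    {p : ℤ → A} {S : Set ℤ} {K t : ℕ} (hSK : ∀ w ∈ S, w.natAbs ≤ K)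
    (hpK : ∀ i : ℤ, K < i.natAbs → p i = z)
    (hw : ∀ x : ℤ → A, (∀ w ∈ S, x w = p w) → ∀ n ≥ t, ∀ i : ℤ, i.natAbs ≤ r → F^[n] x i = z)
    (e : ℤ) (he : 2 * ((K : ℤ) + (r * t : ℕ)) < e) :
    ∃ n, F^[n] (fun i => if 2 * i ≤ e then cutR z 0 (F^[t] p) i
      else cutL z 0 (F^[t] p) (i - e)) = fun _ => z := by
  let X : ℤ → A := fun i => if 2 * i ≤ e then p i else p (i - e)
  have hl := h.iter dZ_self dZ_tri t
  have w0 : ∀ n ≥ t, ∀ i : ℤ, i.natAbs ≤ r → F^[n] X i = z := by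
    apply hw
    intro w hwS
    have := hSK w hwS
    simp only [X]
    rw [if_pos (by omega)]
  have we : ∀ n ≥ t, ∀ i : ℤ, (i - e).natAbs ≤ r → F^[n] X i = z := by
    intro n hnt i hi
    have := hw (fun i => X (i + e)) (by
      intro w hwS
      have := hSK w hwS
      simp only [X]
      rw [if_neg (by omega)]
      simp) n hnt (i - e) hi
    rw [shift_iter hsh] at this
    simpa using this
  have hX : ∀ i, F^[t] X i = if 2 * i ≤ e then F^[t] p i else F^[t] p (i - e) := by
    intro i
    split_ifs with hi
    · apply hl
      intro w hw'
      simp only [dZ] at hw'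
      simp only [X]
      split_ifs with h1
      · rfl
      · rw [hpK w (by omega), hpK (w - e) (by omega)]
    · have : F^[t] X i = F^[t] (fun i => X (i + e)) (i - e) := by
        rw [shift_iter hsh]; simp
      rw [this]
      apply hl
      intro w hw'
      simp only [dZ] at hw'
      simp only [X]
      split_ifs with h1
      · rw [hpK w (by omega), hpK (w + e) (by omega)]
      · simp
  have hY : (fun i => if 2 * i ≤ e then cutR z 0 (F^[t] p) i
      else cutL z 0 (F^[t] p) (i - e)) = cutL z e (cutR z 0 (F^[t] X)) := by
    funext i
    simp only [cutR, cutL, hX]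
    split_ifs <;> first | rfl | omega
  rw [hY]
  have wr := wallR h hz 0 (F^[t] X) (by
    intro n i hi
    rw [← Function.iterate_add_apply]
    exact w0 _ (by omega) i (by simpa using hi))
  have wl := wallL h hz e (cutR z 0 (F^[t] X)) (by
    intro n i hi
    rw [wr]
    simp only [cutR]
    split_ifs
    · rw [← Function.iterate_add_apply]
      exact we _ (by omega) i hi
    · rfl)
  obtain ⟨n, hn1⟩ := hn.finite X (Set.finite_Icc 0 e)
  refine ⟨n, ?_⟩
  rw [wl, wr]
  funext i
  simp only [cutL, cutR]
  split_ifs with h1 h2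
  · rw [← Function.iterate_add_apply]
    exact hn1 _ (by omega) i ⟨h2, h1⟩
  · rfl
  · rfl

theorem oneD {A : Type*} [Finite A] [TopologicalSpace A] [DiscreteTopology A]
    {z : A} {F : (ℤ → A) → (ℤ → A)} (hF : Continuous F) (hn : AN F z)
    (hsh : ∀ x c, F (fun i => x (i + c)) = fun i => F x (i + c)) :
    ∃ n, ∀ x, F^[n] x = fun _ => z := by
  classical
  have htr : ∀ u v : ℤ, ∃ g : Equiv.Perm ℤ, g u = v ∧ (∀ a b, dZ (g a) (g b) = dZ a b) ∧
      ∀ x : ℤ → A, F (fun t => x (g.symm t)) = fun t => F x (g.symm t) := by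
    intro u v
    refine ⟨Equiv.addRight (v - u), by simp, by simp [dZ], ?_⟩
    intro x
    have := hsh x (-(v - u))
    simpa using this
  obtain ⟨r, h⟩ := exists_radius hF 0 htr
  have hz := fix_z dZ_fin h hn
  obtain ⟨p0, -, S, hS, t, hw0⟩ := baire hF hn Set.univ ⟨fun _ => z, trivial⟩ (dZ_fin 0 r)
  let p : ℤ → A := fun w => if w ∈ S then p0 w else z
  have hw : ∀ x : ℤ → A, (∀ w ∈ S, x w = p w) → ∀ n ≥ t, ∀ i : ℤ, i.natAbs ≤ r →
      F^[n] x i = z := by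
    intro x hx n hnt i hi
    refine hw0 x trivial ?_ n hnt i (by simpa [dZ] using hi)
    intro w hwS
    rw [hx w hwS]
    simp [p, hwS]
  obtain ⟨K, hK⟩ := (hS.image Int.natAbs).bddAbove
  have hSK : ∀ w ∈ S, w.natAbs ≤ K := fun w hw => hK ⟨w, hw, rfl⟩
  have hpK : ∀ i : ℤ, K < i.natAbs → p i = z := by
    intro i hi
    have : i ∉ S := fun h => by have := hSK i h; omega
    simp [p, this]
  by_cases hm : ∃ T, F^[T] p = fun _ => z
  · obtain ⟨T, hT⟩ := hm
    refine stepC (d := dZ) (r := r) dZ_self dZ_comm dZ_tri dZ_fin hF h hn ?_ (o := 0) (p := p) hS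
      (t := t) (T := T) ?_ hT ?_
    · intro u v
      obtain ⟨g, h1, -, h2⟩ := htr u v
      exact ⟨g, h1, h2⟩
    · refine hS.subset ?_
      intro w hw
      by_contra hc
      exact hw (by simp [p, hc])
    · intro x hx n hnt
      exact hw x hx n hnt 0 (by simp)
  exfalso
  set u := F^[t] p with hu
  obtain ⟨Ku, hKu⟩ : ∃ Ku, Ku = K + r * t := ⟨_, rfl⟩
  have huK : ∀ i : ℤ, Ku < i.natAbs → u i = z := fun i hi => suppZ h hz hpK t i (by omega)
  have huw : ∀ n i, (i - 0 : ℤ).natAbs ≤ r → F^[n] u i = z := by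
    intro n i hi
    rw [hu, ← Function.iterate_add_apply]
    exact hw p (fun _ _ => rfl) _ (by omega) i (by simpa using hi)
  set q := cutR z 0 u with hq
  set l := cutL z 0 u with hl
  have hqn := wallR h hz 0 u huw
  have hln := wallL h hz 0 u huw
  rw [← hq] at hqn
  rw [← hl] at hln
  have hnon : ∀ n, ¬ (F^[n] q = (fun _ => z) ∧ F^[n] l = fun _ => z) := by
    rintro n ⟨h1, h2⟩
    apply hm
    refine ⟨n + t, ?_⟩
    rw [Function.iterate_add_apply]
    funext i
    rcases le_total 0 i with hi | hi
    · have := congrFun h1 i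
      rw [hqn] at this
      simpa [cutR, hi] using this
    · have := congrFun h2 i
      rw [hln] at this
      simpa [cutL, hi] using this
  have hqK : ∀ i : ℤ, Ku < i.natAbs → q i = z := by
    intro i hi
    simp only [hq, cutR, huK i hi, ite_self]
  have hlK : ∀ i : ℤ, Ku < i.natAbs → l i = z := by
    intro i hi
    simp only [hl, cutL, huK i hi, ite_self]
  have hq0 : ∀ n i, i < 0 → F^[n] q i = z := by
    intro n i hi
    rw [hqn]
    simp only [cutR]
    rw [if_neg (by omega)]
  have hl0 : ∀ n i, 0 < i → F^[n] l i = z := by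
    intro n i hi
    rw [hln]
    simp only [cutL]
    rw [if_neg (by omega)]
  have hzc : ∀ n i, F^[n] (fun _ : ℤ => z) i = z := fun n i => by rw [iter_fix hz]
  refine stepE dZ_self dZ_comm dZ_tri dZ_fin hF h hn (0 : ℤ) ?_
  intro m T t0
  obtain ⟨M, hM⟩ : ∃ M, M = m + Ku + r * T + 2 * r + 1 := ⟨_, rfl⟩
  obtain ⟨n1, hn1⟩ := hn.finite q (dZ_fin 0 M)
  obtain ⟨n2, hn2⟩ := hn.finite l (dZ_fin 0 M)
  obtain ⟨n0, hn01, hn02, hn0T, hn0t⟩ : ∃ n0, n1 ≤ n0 ∧ n2 ≤ n0 ∧ T ≤ n0 ∧ t0 ≤ n0 :=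
    ⟨n1 + n2 + T + t0, by omega, by omega, by omega, by omega⟩
  obtain ⟨e, he⟩ : ∃ e : ℤ, e = 2 * r + 2 * Ku + 2 * (r * n0 : ℕ) + 1 := ⟨_, rfl⟩
  obtain ⟨nY, hnY⟩ := box_mortal h hz hn hsh hSK hpK hw e (by omega)
  rw [← hu, ← hq, ← hl] at hnY
  set Y : ℤ → A := fun i => if 2 * i ≤ e then q i else l (i - e) with hY
  let Adj : ℕ → Prop := fun n => ∀ i, (F^[n] q i = z ∧ F^[n] Y i = F^[n] l (i - e)) ∨
    (F^[n] l (i - e) = z ∧ F^[n] Y i = F^[n] q i)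
  let Meet : ℕ → Prop := fun n => ∃ a b : ℤ, (a - b).natAbs ≤ 2 * r ∧ F^[n] q a ≠ z ∧
    F^[n] l (b - e) ≠ z
  have hAdj0 : Adj 0 := by
    intro i
    simp only [Function.iterate_zero, id, hY]
    split_ifs with h1
    · exact Or.inr ⟨hlK _ (by omega), rfl⟩
    · exact Or.inl ⟨hqK _ (by omega), rfl⟩
  have hstep : ∀ n, Adj n → ¬ Meet n → Adj (n + 1) := by
    intro n hA hM i
    simp only [Function.iterate_succ_apply']
    by_cases hc : ∀ w, dZ i w ≤ r → F^[n] q w = z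
    · left
      constructor
      · have : F (fun _ => z) i = z := by rw [hz]
        exact Eq.trans (h _ _ _ hc) this
      · have h1 := congrFun (hsh (F^[n] l) (-e)) i
        simp only [← sub_eq_add_neg] at h1
        rw [← h1]
        apply h
        intro w hw
        rcases hA w with ⟨_, h2⟩ | ⟨h2, h3⟩
        · exact h2
        · rw [h3, hc w hw, h2]
    · right
      push Not at hc
      obtain ⟨a, ha, hqa⟩ := hc
      have hlz : ∀ w, dZ i w ≤ r → F^[n] l (w - e) = z := by
        intro w hw
        by_contra hne
        apply hM
        refine ⟨a, w, ?_, hqa, hne⟩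
        simp only [dZ] at ha hw
        omega
      constructor
      · have h1 := congrFun (hsh (F^[n] l) (-e)) i
        simp only [← sub_eq_add_neg] at h1
        rw [← h1]
        have : F (fun _ => z) i = z := by rw [hz]
        exact Eq.trans (h _ _ _ hlz) this
      · apply h
        intro w hw
        rcases hA w with ⟨h2, h3⟩ | ⟨_, h3⟩
        · rw [h3, h2, hlz w hw]
        · exact h3
  have hMeet : ∃ n, Meet n := by
    by_contra hno
    push Not at hno
    have hall : ∀ n, Adj n := by
      intro n
      induction n with
      | zero => exact hAdj0
      | succ n ih => exact hstep n ih (hno n)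
    have hz' : ∀ i, F^[nY] q i = z ∧ F^[nY] l (i - e) = z := by
      intro i
      have hYi : F^[nY] Y i = z := by rw [hnY]
      rcases hall nY i with ⟨h1, h2⟩ | ⟨h1, h2⟩
      · exact ⟨h1, by rw [← h2, hYi]⟩
      · exact ⟨by rw [← h2, hYi], h1⟩
    apply hnon nY
    constructor
    · funext i; exact (hz' i).1
    · funext i
      have := (hz' (i + e)).2
      simpa using this
  obtain ⟨a, b, hab, hqa, hlb⟩ := Nat.find_spec hMeet
  set n := Nat.find hMeet with hnf
  have hAdjn : ∀ j ≤ n, Adj j := by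
    intro j
    induction j with
    | zero => intro _; exact hAdj0
    | succ j ih =>
      intro hj
      exact hstep j (ih (by omega)) (Nat.find_min hMeet (by omega))
  have hYa : F^[n] Y a ≠ z := by
    rcases hAdjn n le_rfl a with ⟨h1, _⟩ | ⟨_, h2⟩
    · exact absurd h1 hqa
    · rw [h2]; exact hqa
  have ha1 : a.natAbs ≤ Ku + r * n := by
    by_contra hc
    exact hqa (suppZ h hz hqK n a (by omega))
  have hb1 : (b - e).natAbs ≤ Ku + r * n := by
    by_contra hc
    exact hlb (suppZ h hz hlK n _ (by omega))
  have hnn0 : n0 ≤ n := by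
    by_contra hc
    have : r * n ≤ r * n0 := Nat.mul_le_mul_left _ (by omega)
    omega
  have ha2 : (M : ℤ) < a := by
    have h1 : ¬ a < 0 := fun hc => hqa (hq0 n a hc)
    have h2 : ¬ a.natAbs ≤ M := fun hc => hqa (hn1 n (by omega) a (by simpa [dZ] using hc))
    omega
  have hb2 : b - e < -(M : ℤ) := by
    have h1 : ¬ 0 < b - e := fun hc => hlb (hl0 n _ hc)
    have h2 : ¬ (b - e).natAbs ≤ M := fun hc => hlb (hn2 n (by omega) _ (by
      simp only [dZ, Set.mem_ofPred_eq]; omega))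
    omega
  refine ⟨fun i => Y (i + a), ?_, ⟨nY, ?_⟩, ?_, ?_, n, by omega, ?_⟩
  · refine (Set.finite_Icc (-a - Ku) (e - a + Ku)).subset ?_
    intro w hw
    by_contra hc
    apply hw
    simp only [Set.mem_Icc] at hc
    simp only [hY]
    split_ifs with h1
    · apply hqK; omega
    · apply hlK; omega
  · rw [shift_iter hsh, hnY]
  · intro w hw
    simp only [dZ] at hw
    simp only [hY]
    split_ifs with h1
    · apply hqK; omega
    · apply hlK; omega
  · intro w hw
    simp only [dZ] at hw
    rw [shift_iter hsh]
    rcases hAdjn T (by omega) (w + a) with ⟨_, h2⟩ | ⟨_, h2⟩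
    · exact h2.trans (suppZ h hz hlK T _ (by omega))
    · exact h2.trans (suppZ h hz hqK T _ (by omega))
  · rw [shift_iter hsh]
    simpa using hYa

structure Horo {V : Type*} (T : SimpleGraph V) where
  π : V → V
  h : V → ℤ
  adj : ∀ a b, T.Adj a b ↔ b = π a ∨ a = π b
  hπ : ∀ v, h (π v) = h v - 1
  conf : ∀ u v, ∃ a b, π^[a] u = π^[b] v
  fin : ∀ v, {w | π w = v}.Finite
  card : ∀ v v', Nat.card {w | π w = v} = Nat.card {w | π w = v'}
  ne : ∀ v, ∃ w, π w = v

namespace Horo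

variable {V : Type*} {T : SimpleGraph V}

theorem h_iter (H : Horo T) (n : ℕ) (v : V) : H.h (H.π^[n] v) = H.h v - n := by
  induction n with
  | zero => simp
  | succ n ih => rw [Function.iterate_succ_apply', H.hπ, ih]; push_cast; ring

theorem ext_beta (H : Horo T) (S : Set V) (g0 : V → V)
    (hg : ∀ s ∈ S, g0 (H.π s) = H.π (g0 s)) (hinj : Set.InjOn g0 S) (v v' : V) :
    ∃ β : V → V, Set.BijOn β {w | H.π w = v} {w | H.π w = v'} ∧
      (v' = g0 v → ∀ s ∈ S, H.π s = v → β s = g0 s) := by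
  classical
  have hfi : Fintype {w | H.π w = v} := (H.fin v).fintype
  have hfi' : Fintype {w | H.π w = v'} := (H.fin v').fintype
  have hc : Fintype.card {w | H.π w = v} = (Finset.card (H.fin v').toFinset) := by
    rw [← Nat.card_eq_card_finite_toFinset, ← Nat.card_eq_fintype_card]
    exact H.card v v'
  let s : Set {w | H.π w = v} := {w | v' = g0 v ∧ (w : V) ∈ S}
  obtain ⟨e, he⟩ := Set.MapsTo.exists_equiv_extend_of_card_eq hc (s := s) (f := fun w => g0 w)
    (by
      rintro ⟨w, hw⟩ ⟨h1, h2⟩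
      simp only [Set.mem_ofPred_eq] at hw
      simp only [Set.Finite.coe_toFinset, Set.mem_ofPred_eq]
      rw [h1, ← hw, hg w h2])
    (by
      rintro ⟨w, hw⟩ ⟨h1, h2⟩ ⟨w', hw'⟩ ⟨h1', h2'⟩ heq
      exact Subtype.ext (hinj h2 h2' heq))
  refine ⟨fun w => if hw : H.π w = v then (e ⟨w, hw⟩ : V) else w, ⟨?_, ?_, ?_⟩, ?_⟩
  · intro w hw
    simp only [Set.mem_ofPred_eq] at hw
    have := (e ⟨w, hw⟩).2
    simpa [hw] using this
  · intro w hw w' hw' heq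
    simp only [Set.mem_ofPred_eq] at hw hw'
    simp only [dif_pos hw, dif_pos hw'] at heq
    have := e.injective (Subtype.ext heq)
    exact congrArg Subtype.val this
  · intro w hw
    obtain ⟨⟨u, hu⟩, h2⟩ := e.surjective ⟨w, by simpa using hw⟩
    refine ⟨u, hu, ?_⟩
    simp only [Set.mem_ofPred_eq] at hu
    simp only [dif_pos hu, h2]
  · intro h1 w hw hwv
    simp only [dif_pos hwv]
    exact he ⟨w, hwv⟩ ⟨h1, hw⟩

theorem comm_iter (H : Horo T) {g : V → V} (hg : ∀ v, g (H.π v) = H.π (g v)) (n : ℕ) (v : V) :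
    g (H.π^[n] v) = H.π^[n] (g v) := by
  induction n with
  | zero => rfl
  | succ n ih => rw [Function.iterate_succ_apply', hg, ih, Function.iterate_succ_apply']

theorem extend (H : Horo T) (S : Set V) (hne : S.Nonempty) (g0 : V → V)
    (hS : ∀ s ∈ S, H.π s ∈ S)
    (hg : ∀ s ∈ S, g0 (H.π s) = H.π (g0 s)) (hinj : Set.InjOn g0 S) :
    ∃ g : T ≃g T, (∀ v, g (H.π v) = H.π (g v)) ∧ (∀ s ∈ S, g s = g0 s) ∧
      ∀ u v, H.h (g u) - H.h u = H.h (g v) - H.h v := by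
  classical
  choose β hβ1 hβ2 using H.ext_beta S g0 hg hinj
  have hSn : ∀ n, ∀ s ∈ S, H.π^[n] s ∈ S := by
    intro n
    induction n with
    | zero => intro s hs; exact hs
    | succ n ih => intro s hs; exact ih _ (hS s hs)
  have hgn : ∀ n, ∀ s ∈ S, g0 (H.π^[n] s) = H.π^[n] (g0 s) := by
    intro n
    induction n with
    | zero => intro s hs; rfl
    | succ n ih =>
      intro s hs
      rw [Function.iterate_succ_apply, Function.iterate_succ_apply, ih _ (hS s hs), hg s hs]
  have hex : ∀ v, ∃ n, H.π^[n] v ∈ S := by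
    intro v
    obtain ⟨s, hs⟩ := hne
    obtain ⟨a, b, hab⟩ := H.conf v s
    exact ⟨a, hab ▸ hSn b s hs⟩
  let G : ℕ → V → V := fun n => Nat.rec (fun v => g0 v)
    (fun _ Gn v => β (H.π v) (Gn (H.π v)) v) n
  let g : V → V := fun v => G (Nat.find (hex v)) v
  have g1 : ∀ s ∈ S, g s = g0 s := by
    intro s hs
    have : Nat.find (hex s) = 0 := by rw [Nat.find_eq_zero]; exact hs
    change G (Nat.find (hex s)) s = _
    rw [this]
    rfl
  have g2 : ∀ v, g v = β (H.π v) (g (H.π v)) v := by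
    intro v
    by_cases hv : v ∈ S
    · rw [g1 v hv, g1 _ (hS v hv)]
      exact (hβ2 _ _ rfl v hv rfl).symm
    · have : Nat.find (hex v) = Nat.find (hex (H.π v)) + 1 :=
        Nat.find_comp_succ (hex v) (hex (H.π v)) hv
      change G (Nat.find (hex v)) v = _
      rw [this]
  have g3 : ∀ v, g (H.π v) = H.π (g v) := by
    intro v
    have : H.π (β (H.π v) (g (H.π v)) v) = g (H.π v) := (hβ1 (H.π v) (g (H.π v))).1 rfl
    rw [g2 v, this]
  have gi : ∀ n, ∀ u v, H.π^[n] u ∈ S → H.π^[n] v ∈ S → g u = g v → u = v := by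
    intro n
    induction n with
    | zero =>
      intro u v hu hv huv
      rw [g1 u hu, g1 v hv] at huv
      exact hinj hu hv huv
    | succ n ih =>
      intro u v hu hv huv
      have h1 : H.π u = H.π v := ih _ _ hu hv (by rw [g3, g3, huv])
      refine (hβ1 (H.π u) (g (H.π u))).2.1 rfl h1.symm ?_
      rw [← g2 u]
      rw [h1, ← g2 v, huv]
  have ginj : Function.Injective g := by
    intro u v huv
    obtain ⟨a, ha⟩ := hex u
    obtain ⟨b, hb⟩ := hex v
    refine gi (a + b) u v ?_ ?_ huv
    · rw [Nat.add_comm, Function.iterate_add_apply]; exact hSn _ _ ha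
    · rw [Function.iterate_add_apply]; exact hSn _ _ hb
  have gs : ∀ n, ∀ w, H.π^[n] w ∈ g0 '' S → ∃ v, g v = w := by
    intro n
    induction n with
    | zero =>
      rintro w ⟨s, hs, h⟩
      exact ⟨s, by rw [g1 s hs]; exact h⟩
    | succ n ih =>
      intro w hw
      obtain ⟨v', hv'⟩ := ih _ hw
      obtain ⟨v, hv, hvw⟩ := (hβ1 v' (g v')).2.2 (show w ∈ {w | H.π w = g v'} from hv'.symm)
      refine ⟨v, ?_⟩
      have hv2 : H.π v = v' := hv
      rw [g2, hv2, hvw]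
  have gsur : Function.Surjective g := by
    intro w
    obtain ⟨s, hs⟩ := hne
    obtain ⟨a, b, hab⟩ := H.conf w (g0 s)
    exact gs a w ⟨H.π^[b] s, hSn b s hs, by rw [hab, hgn b s hs]⟩
  let e : V ≃ V := Equiv.ofBijective g ⟨ginj, gsur⟩
  refine ⟨⟨e, ?_⟩, g3, g1, ?_⟩
  · intro a b
    change T.Adj (g a) (g b) ↔ _
    rw [H.adj, H.adj, ← g3, ← g3, ginj.eq_iff, ginj.eq_iff]
  · intro u v
    change H.h (g u) - H.h u = H.h (g v) - H.h v
    obtain ⟨a, b, hab⟩ := H.conf u v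
    have e1 := H.h_iter a u
    have e2 := H.h_iter b v
    have e3 := H.h_iter a (g u)
    have e4 := H.h_iter b (g v)
    rw [← H.comm_iter g3] at e3 e4
    rw [hab] at e1 e3
    omega

theorem ray_tail (H : Horo T) {u : V} {m n : ℕ} (h : H.π^[m] u = H.π^[n] u) : m = n := by
  have e1 := H.h_iter m u
  have e2 := H.h_iter n u
  rw [h] at e1
  omega

/-- level-shifting transitivity. -/
theorem trans (H : Horo T) (u u' : V) : ∃ g : T ≃g T, g u = u' ∧
    ∀ w, H.h (g w) = H.h w + (H.h u' - H.h u) := by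
  have key : ∀ n, H.π^[(H.h u - H.h (H.π^[n] u)).toNat] u' = H.π^[n] u' := by
    intro n
    rw [H.h_iter]
    congr 2
    omega
  obtain ⟨g, -, g2, g3⟩ := H.extend {v | ∃ n : ℕ, v = H.π^[n] u} ⟨u, 0, rfl⟩
    (fun v => H.π^[(H.h u - H.h v).toNat] u')
    (by rintro s ⟨n, rfl⟩; exact ⟨n + 1, (Function.iterate_succ_apply' _ _ _).symm⟩)
    (by
      rintro s ⟨n, rfl⟩
      have := key (n + 1)
      rw [Function.iterate_succ_apply'] at this
      simp only [this, key n, Function.iterate_succ_apply'])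
    (by
      rintro s ⟨n, rfl⟩ s' ⟨m, rfl⟩ hh
      simp only [key] at hh
      rw [H.ray_tail hh])
  have gu : g u = u' := by
    rw [g2 u ⟨0, rfl⟩]; simp
  refine ⟨g, gu, fun w => ?_⟩
  have := g3 w u
  rw [gu] at this
  omega

theorem surj (H : Horo T) (u : V) (i : ℤ) : ∃ v, H.h v = i := by
  have up : ∀ n : ℕ, ∃ v, H.h v = H.h u + n := by
    intro n
    induction n with
    | zero => exact ⟨u, by simp⟩
    | succ n ih =>
      obtain ⟨v, hv⟩ := ih
      obtain ⟨w, hw⟩ := H.ne v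
      refine ⟨w, ?_⟩
      have := H.hπ w
      rw [hw] at this
      push_cast
      omega
  rcases le_total (H.h u) i with h | h
  · obtain ⟨v, hv⟩ := up (i - H.h u).toNat
    exact ⟨v, by omega⟩
  · exact ⟨H.π^[(H.h u - i).toNat] u, by rw [H.h_iter]; omega⟩

def D (H : Horo T) (v : V) : Set V := {w | ∃ a, H.π^[a] w = v}

/-- Local level transitivity inside `D v`. -/
theorem local_trans (H : Horo T) (v w w' : V) (hw : w ∈ H.D v) (hw' : w' ∈ H.D v)
    (hh : H.h w = H.h w') : ∃ g : T ≃g T, g w = w' ∧ ∀ x, x ∉ H.D v → g x = x := by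
  classical
  have key : ∀ n, H.π^[(H.h w - H.h (H.π^[n] w)).toNat] w' = H.π^[n] w' := by
    intro n
    rw [H.h_iter]
    congr 2
    omega
  obtain ⟨a, ha⟩ := hw
  obtain ⟨b, hb⟩ := hw'
  have hab : a = b := by
    have e1 := H.h_iter a w
    have e2 := H.h_iter b w'
    rw [ha] at e1
    rw [hb] at e2
    omega
  subst hab
  -- elements of the ray from w that are in D v
  have hD : ∀ y n, H.π^[a] y = v → (H.π^[n] y ∈ H.D v ↔ n ≤ a) := by
    intro y n hy
    constructor
    · rintro ⟨c, hc⟩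
      rw [← Function.iterate_add_apply, ← hy] at hc
      have := H.ray_tail hc
      omega
    · intro hn
      refine ⟨a - n, ?_⟩
      rw [← Function.iterate_add_apply, ← hy]
      congr 2
      omega
  have hbeyond : ∀ n, a ≤ n → H.π^[n] w = H.π^[n] w' := by
    intro n hn
    obtain ⟨c, rfl⟩ := Nat.exists_eq_add_of_le hn
    rw [Nat.add_comm, Function.iterate_add_apply, Function.iterate_add_apply, ha, hb]
  let g0 : V → V := fun x => if x ∈ H.D v then H.π^[(H.h w - H.h x).toNat] w' else x
  have k1 : ∀ n, g0 (H.π^[n] w) = H.π^[n] w' := by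
    intro n
    simp only [g0]
    split_ifs with h1
    · exact key n
    · rw [hD w n ha] at h1
      exact hbeyond n (by omega)
  have k2 : ∀ x, x ∉ H.D v → g0 x = x := fun x hx => if_neg hx
  have k3 : ∀ x, x ∉ H.D v → H.π x ∉ H.D v := by
    rintro x hx ⟨c, hc⟩
    exact hx ⟨c + 1, hc⟩
  obtain ⟨g, -, g2, -⟩ := H.extend {x | (∃ n : ℕ, x = H.π^[n] w) ∨ x ∉ H.D v}
    ⟨w, Or.inl ⟨0, rfl⟩⟩ g0
    (by
      rintro s (⟨n, rfl⟩ | hs)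
      · exact Or.inl ⟨n + 1, (Function.iterate_succ_apply' _ _ _).symm⟩
      · exact Or.inr (k3 s hs))
    (by
      rintro s (⟨n, rfl⟩ | hs)
      · rw [k1, ← Function.iterate_succ_apply' H.π n w, k1, Function.iterate_succ_apply']
      · rw [k2 s hs, k2 _ (k3 s hs)])
    (by
      have aux : ∀ n x, x ∉ H.D v → g0 (H.π^[n] w) = g0 x → H.π^[n] w = x := by
        intro n x hx he
        rw [k1, k2 x hx] at he
        subst he
        rw [hD w' n hb] at hx
        exact hbeyond n (by omega)
      rintro s (⟨n, rfl⟩ | hs) s' (⟨m, rfl⟩ | hs') he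
      · rw [k1, k1] at he
        rw [H.ray_tail he]
      · exact aux n _ hs' he
      · exact (aux m _ hs he.symm).symm
      · rwa [k2 s hs, k2 s' hs'] at he)
  refine ⟨g, ?_, fun x hx => ?_⟩
  · rw [g2 w (Or.inl ⟨0, rfl⟩)]; exact k1 0
  · rw [g2 x (Or.inr hx), k2 x hx]

theorem D_adj (H : Horo T) {v w w' : V} (hw : w ∈ H.D v) (hne : w ≠ v) (ha : T.Adj w w') :
    w' ∈ H.D v := by
  obtain ⟨a, ha'⟩ := hw
  rcases (H.adj w w').1 ha with h | h
  · cases a with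
    | zero => exact absurd ha' hne
    | succ a => exact ⟨a, by rw [h]; exact ha'⟩
  · exact ⟨a + 1, by rw [Function.iterate_succ_apply, ← h]; exact ha'⟩

theorem D_walk (H : Horo T) {v w w' : V} (p : T.Walk w w') (hw : w ∈ H.D v)
    (hd : p.length < T.dist v w ∨ p.length = 0) : w' ∈ H.D v := by
  induction p with
  | nil => exact hw
  | @cons a b c hab p ih =>
    have h1 : p.length + 1 < T.dist v a := by
      rcases hd with h | h
      · simpa using h
      · simp at h
    have hne : a ≠ v := by rintro rfl; simp at h1
    refine ih (H.D_adj hw hne hab) (Or.inl ?_)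
    have := hab.symm.diff_dist_adj (u := v)
    omega

end Horo

theorem up_unique {V : Type*} {T : SimpleGraph V} (hconn : T.Connected) (hacyc : T.IsAcyclic)
    {o a b c : V} (hb : T.Adj a b) (hc : T.Adj a c) (hb' : T.dist o b < T.dist o a)
    (hc' : T.dist o c < T.dist o a) : b = c := by
  have key : ∀ b, T.Adj a b → T.dist o b < T.dist o a → ∃ p : T.Walk o a, p.IsPath ∧
      p.penultimate = b := by
    intro b hb hb'
    obtain ⟨p, hp⟩ := hconn.exists_walk_length_eq_dist o b
    refine ⟨p.concat hb.symm, ?_, by simp⟩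
    apply SimpleGraph.Walk.isPath_of_length_eq_dist
    have := T.dist_le (p.concat hb.symm)
    rw [SimpleGraph.Walk.length_concat] at *
    omega
  obtain ⟨p, hp, hp'⟩ := key b hb hb'
  obtain ⟨q, hq, hq'⟩ := key c hc hc'
  have := (hacyc.subsingleton_path o a).elim ⟨p, hp⟩ ⟨q, hq⟩
  have : p = q := congrArg Subtype.val this
  rw [← hp', ← hq', this]

theorem exists_horo {V : Type*} {T : SimpleGraph V} (hconn : T.Connected) (hacyc : T.IsAcyclic)
    {k : ℕ} (hk : 2 ≤ k) (hreg : ∀ v : V, Nat.card (T.neighborSet v) = k)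
    (o c : V) (hoc : T.Adj o c) : ∃ H : Horo T, H.π o = c := by
  classical
  have htree : T.IsTree := ⟨hconn, hacyc⟩
  have hfinN : ∀ v, (T.neighborSet v).Finite := fun v =>
    Set.finite_coe_iff.1 (Nat.finite_of_card_ne_zero (by rw [hreg]; omega))
  -- differences
  have hd : ∀ a b, T.Adj a b → T.dist o a + 1 = T.dist o b ∨ T.dist o b + 1 = T.dist o a := by
    intro a b hab
    have h1 := htree.dist_ne_of_adj o hab
    have h2 := hab.diff_dist_adj (u := o)
    omega
  have hother : ∀ a b, ∃ e, T.Adj a e ∧ e ≠ b := by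
    intro a b
    by_contra hcon
    push Not at hcon
    have : T.neighborSet a ⊆ {b} := fun e he => hcon e he
    have h2 := Set.ncard_le_ncard this (Set.finite_singleton b)
    rw [Set.ncard_singleton, ← Nat.card_coe_set_eq, hreg] at h2
    omega
  choose nx hnx1 hnx2 using hother
  let R : ℕ → V × V := fun n => Nat.rec (o, c) (fun _ q => (q.2, nx q.2 q.1)) n
  let ρ : ℕ → V := fun n => (R n).1
  have ρ0 : ρ 0 = o := rfl
  have ρ1 : ρ 1 = c := rfl
  have ρ2 : ∀ n, ρ (n + 2) = nx (ρ (n + 1)) (ρ n) := fun n => rfl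
  have ρadj : ∀ n, T.Adj (ρ n) (ρ (n + 1)) := by
    intro n
    cases n with
    | zero => exact hoc
    | succ n => rw [ρ2]; exact hnx1 _ _
  have ρd : ∀ n, T.dist o (ρ n) = n ∧ T.dist o (ρ (n + 1)) = n + 1 := by
    intro n
    induction n with
    | zero =>
      refine ⟨by rw [ρ0]; simp, ?_⟩
      have h0 : T.dist o (ρ 0) = 0 := by rw [ρ0]; simp
      have := hd _ _ (ρadj 0)
      omega
    | succ n ih =>
      refine ⟨ih.2, ?_⟩
      rcases hd _ _ (ρadj (n + 1)) with h | h
      · omega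
      · exfalso
        refine hnx2 (ρ (n + 1)) (ρ n) ?_
        rw [← ρ2]
        have e : T.dist o (ρ (n + 2)) = T.dist o (ρ (n + 1 + 1)) := rfl
        exact up_unique (o := o) hconn hacyc (ρadj (n + 1)) (ρadj n).symm (by omega) (by omega)
  have ρd1 : ∀ n, T.dist o (ρ n) = n := fun n => (ρd n).1
  have hpar : ∀ w, ∃ p, w ≠ o → T.Adj w p ∧ T.dist o p + 1 = T.dist o w := by
    intro w
    by_cases hw : w = o
    · exact ⟨o, fun h => absurd hw h⟩
    · obtain ⟨p, hp⟩ := hconn.exists_walk_length_eq_dist w o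
      cases p with
      | nil => exact absurd rfl hw
      | @cons _ b _ hab q =>
        refine ⟨b, fun _ => ⟨hab, ?_⟩⟩
        have h1 := T.dist_le q
        rw [SimpleGraph.Walk.length_cons] at hp
        rw [SimpleGraph.dist_comm] at h1 hp
        have := hd _ _ hab
        omega
  choose par hp using hpar
  let π : V → V := fun w => if w = ρ (T.dist o w) then ρ (T.dist o w + 1) else par w
  have πρ : ∀ n, π (ρ n) = ρ (n + 1) := by
    intro n
    simp only [π, ρd1, if_true]
  have πn : ∀ w, (∀ i, w ≠ ρ i) → w ≠ o ∧ π w = par w := by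
    intro w hw
    refine ⟨hw 0, ?_⟩
    simp only [π]
    rw [if_neg (hw _)]
  have πadj : ∀ w, T.Adj w (π w) := by
    intro w
    by_cases hw : ∃ i, w = ρ i
    · obtain ⟨i, rfl⟩ := hw
      rw [πρ]; exact ρadj i
    · push Not at hw
      obtain ⟨h1, h2⟩ := πn w hw
      rw [h2]; exact (hp w h1).1
  have adj1 : ∀ a b, T.Adj a b → T.dist o b + 1 = T.dist o a → b = π a ∨ a = π b := by
    intro a b hab hlt
    by_cases hw : ∃ i, a = ρ i
    · obtain ⟨i, rfl⟩ := hw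
      right
      cases i with
      | zero => rw [ρd1] at hlt; omega
      | succ n =>
        have : b = ρ n := up_unique (o := o) hconn hacyc hab (ρadj n).symm (by omega)
          (by rw [ρd1 n, ρd1 (n + 1)]; omega)
        rw [this, πρ]
    · push Not at hw
      left
      obtain ⟨h1, h2⟩ := πn a hw
      rw [h2]
      have := hp a h1
      exact up_unique (o := o) hconn hacyc hab this.1 (by omega) (by omega)
  have πρn : ∀ n i, π^[n] (ρ i) = ρ (i + n) := by
    intro n i
    induction n with
    | zero => rfl
    | succ n ih => rw [Function.iterate_succ_apply', ih, πρ]; rfl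
  have ρinj : ∀ i j, ρ i = ρ j → i = j := by
    intro i j h
    rw [← ρd1 i, ← ρd1 j, h]
  have hray : ∀ n v, T.dist o v = n → ∃ a i, π^[a] v = ρ i := by
    intro n
    induction n with
    | zero =>
      intro v hv
      exact ⟨0, 0, ((hconn.dist_eq_zero_iff).1 hv).symm⟩
    | succ n ih =>
      intro v hv
      by_cases hw : ∃ i, v = ρ i
      · obtain ⟨i, hi⟩ := hw
        exact ⟨0, i, hi⟩
      · push Not at hw
        obtain ⟨h1, h2⟩ := πn v hw
        obtain ⟨a, i, hai⟩ := ih (π v) (by rw [h2]; have := (hp v h1).2; omega)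
        exact ⟨a + 1, i, hai⟩
  have hray' : ∀ v, ∃ a i, π^[a] v = ρ i := fun v => hray _ v rfl
  choose ha hi hai using hray'
  have hwd : ∀ v a b i j, π^[a] v = ρ i → π^[b] v = ρ j → i + b = j + a := by
    intro v a b i j h1 h2
    apply ρinj
    rw [← πρn, ← πρn, ← h1, ← h2, ← Function.iterate_add_apply, ← Function.iterate_add_apply,
      Nat.add_comm]
  have adjiff : ∀ a b, T.Adj a b ↔ b = π a ∨ a = π b := by
    intro a b
    constructor
    · intro h
      rcases hd _ _ h with h1 | h1
      · exact (adj1 b a h.symm h1).symm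
      · exact adj1 a b h h1
    · rintro (rfl | rfl)
      · exact πadj a
      · exact (πadj b).symm
  have hh : ∀ v, ((ha (π v) : ℤ) - hi (π v)) = (ha v - hi v) - 1 := by
    intro v
    have := hwd v (ha v) (ha (π v) + 1) (hi v) (hi (π v)) (hai v) (hai (π v))
    omega
  have hsub : ∀ v, {w | π w = v} ⊆ T.neighborSet v := by
    intro v w hw
    exact (adjiff v w).2 (Or.inr (Eq.symm hw))
  have hcard : ∀ v, Nat.card {w | π w = v} = k - 1 := by
    intro v
    have h1 : T.neighborSet v = insert (π v) {w | π w = v} := by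
      ext w
      rw [SimpleGraph.mem_neighborSet, adjiff, Set.mem_insert_iff, Set.mem_ofPred_eq, eq_comm (a := v)]
    have h2 : π v ∉ {w | π w = v} := by
      intro h
      have e1 := hh v
      have e2 := hh (π v)
      rw [Set.mem_ofPred_eq] at h
      rw [h] at e2
      omega
    have h3 := Set.ncard_insert_of_notMem h2 ((hfinN v).subset (hsub v))
    rw [← h1, ← Nat.card_coe_set_eq, hreg] at h3
    rw [Nat.card_coe_set_eq]
    omega
  refine ⟨⟨π, fun v => (ha v : ℤ) - hi v, adjiff, hh, ?_, ?_, ?_, ?_⟩, ?_⟩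
  · intro u v
    refine ⟨hi v + ha u, hi u + ha v, ?_⟩
    rw [Function.iterate_add_apply, Function.iterate_add_apply, hai, hai, πρn, πρn, Nat.add_comm]
  · exact fun v => (hfinN v).subset (hsub v)
  · intro v v'; rw [hcard, hcard]
  · intro v
    have : ({w | π w = v} : Set V).Nonempty := by
      rw [Set.nonempty_iff_ne_empty]
      intro h0
      have := hcard v
      rw [h0] at this
      simp at this
      omega
    exact this
  · exact πρ 0

section
variable {V A : Type*} {T : SimpleGraph V}

theorem Horo.level [Finite A] [TopologicalSpace A] [DiscreteTopology A]
    (H : Horo T) (o : V) {z : A} {f : (V → A) → (V → A)}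
    (hf : Continuous f)
    (hcomm : ∀ (g : T ≃g T) (x : V → A),
      f (fun t => x (g.symm t)) = fun t => f x (g.symm t)) (hn : AN f z) :
    ∃ N, ∀ y : ℤ → A, f^[N] (fun v => y (H.h v)) = fun _ => z := by
  choose s hs using H.surj o
  let F : (ℤ → A) → (ℤ → A) := fun y i => f (fun v => y (H.h v)) (s i)
  have key : ∀ y, f (fun v => y (H.h v)) = fun v => F y (H.h v) := by
    intro y
    funext v
    obtain ⟨g, g1, g2⟩ := H.trans v (s (H.h v))
    have h1 := hcomm g (fun v => y (H.h v))
    have h2 : ∀ t, H.h (g.symm t) = H.h t := by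
      intro t
      have := g2 (g.symm t)
      rw [hs] at this
      simp at this
      exact this.symm
    simp only [h2] at h1
    have h3 := congrFun h1 (g v)
    rw [RelIso.symm_apply_apply, g1] at h3
    exact h3.symm
  have keyn : ∀ n y, f^[n] (fun v => y (H.h v)) = fun v => F^[n] y (H.h v) := by
    intro n
    induction n with
    | zero => intro y; rfl
    | succ n ih =>
      intro y
      rw [Function.iterate_succ_apply, key, ih]
      rfl
  have hF : Continuous F := by
    refine continuous_pi fun i => ?_
    refine (continuous_apply (s i)).comp (hf.comp ?_)
    exact continuous_pi fun v => continuous_apply _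
  have hFn : AN F z := by
    intro y i
    obtain ⟨n, hn'⟩ := hn (fun v => y (H.h v)) (s i)
    refine ⟨n, fun m hm => ?_⟩
    have := hn' m hm
    rw [keyn] at this
    simpa only [hs] using this
  have hsh : ∀ x c, F (fun i => x (i + c)) = fun i => F x (i + c) := by
    intro x c
    funext i
    obtain ⟨g, g1, g2⟩ := H.trans (s i) (s (i + c))
    have h1 := hcomm g.symm (fun v => x (H.h v))
    have h2 : ∀ t, H.h (g.symm.symm t) = H.h t + c := by
      intro t
      have := g2 t
      rw [hs, hs] at this
      change H.h (g t) = _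
      omega
    simp only [h2] at h1
    have h3 := congrFun h1 (s i)
    change f (fun t => x (H.h t + c)) (s i) = f (fun v => x (H.h v)) (g (s i)) at h3
    rw [g1] at h3
    exact h3
  obtain ⟨N, hN⟩ := oneD hF hFn hsh
  exact ⟨N, fun y => by rw [keyn, hN]⟩

theorem Horo.patch (hconn : T.Connected)
    (H : Horo T) {z : A} {f : (V → A) → (V → A)} {r N : ℕ}
    (hcomm : ∀ (g : T ≃g T) (x : V → A),
      f (fun t => x (g.symm t)) = fun t => f x (g.symm t))
    (hloc : Loc T.dist r f)
    (hN : ∀ y : ℤ → A, f^[N] (fun v => y (H.h v)) = fun _ => z)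
    {p : V → A} {v : V} (hp : ∀ w ∈ H.D v, p w = z) {u : V} (hu : u ∈ H.D v)
    (hd : r * N < T.dist v u) (s : ℕ) : f^[N + s] p u = z := by
  classical
  have hconst : ∀ w ∈ H.D v, ∀ w' ∈ H.D v, H.h w = H.h w' → f^[s] p w = f^[s] p w' := by
    intro w hw w' hw' hh
    obtain ⟨g, g1, g2⟩ := H.local_trans v w w' hw hw' hh
    have h1 := iter_comm (g := g.toEquiv) (hcomm g) s p
    have h2 : (fun t => p (g.toEquiv.symm t)) = p := by
      funext x
      by_cases hx : x ∈ H.D v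
      · rw [hp x hx]
        apply hp
        by_contra hcon
        have := g2 _ hcon
        have h3 : g (g.toEquiv.symm x) = x := g.apply_symm_apply x
        rw [h3] at this
        exact hcon (this ▸ hx)
      · have : g.toEquiv.symm x = x := by
          rw [Equiv.symm_apply_eq]; exact (g2 x hx).symm
        rw [this]
    rw [h2] at h1
    have h3 := congrFun h1 w'
    rw [h3]
    have h4 : g.toEquiv.symm w' = w := by rw [Equiv.symm_apply_eq]; exact g1.symm
    rw [h4]
  let y : ℤ → A := fun i => if hi : ∃ w ∈ H.D v, H.h w = i then f^[s] p hi.choose else z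
  have hy : ∀ w ∈ H.D v, f^[s] p w = y (H.h w) := by
    intro w hw
    have hex : ∃ w' ∈ H.D v, H.h w' = H.h w := ⟨w, hw, rfl⟩
    simp only [y]
    rw [dif_pos hex]
    exact hconst w hw _ hex.choose_spec.1 hex.choose_spec.2.symm
  rw [Function.iterate_add_apply]
  have hl := Loc.iter (fun a => SimpleGraph.dist_self) (fun a b c => hconn.dist_triangle) hloc N
  rw [hl u (f^[s] p) (fun w => y (H.h w)), hN]
  intro w hw
  apply hy
  obtain ⟨q, hq⟩ := hconn.exists_walk_length_eq_dist u w
  exact H.D_walk q hu (Or.inl (by rw [hq]; exact lt_of_le_of_lt hw hd))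

theorem Horo.D_far (hconn : T.Connected) (hacyc : T.IsAcyclic) (H : Horo T) {o v : V}
    (hv : T.dist o (H.π v) < T.dist o v) {w : V} (hw : w ∈ H.D v) : T.dist o v ≤ T.dist o w := by
  have key : ∀ a w, H.π^[a] w = v → T.dist o v ≤ T.dist o w ∧ T.dist o (H.π w) < T.dist o w := by
    intro a
    induction a with
    | zero =>
      intro w hw
      change w = v at hw
      subst hw
      exact ⟨le_rfl, hv⟩
    | succ a ih =>
      intro w hw
      obtain ⟨h1, h2⟩ := ih (H.π w) hw
      have hadj : T.Adj w (H.π w) := (H.adj _ _).2 (Or.inl rfl)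
      have h3 : T.dist o (H.π w) < T.dist o w := by
        by_contra hcon
        have hne := (SimpleGraph.IsTree.mk hconn hacyc).dist_ne_of_adj o hadj
        have := up_unique (o := o) hconn hacyc ((H.adj _ _).2 (Or.inl rfl)) hadj.symm h2
          (by omega)
        have e1 := H.hπ w
        have e2 := H.hπ (H.π w)
        rw [this] at e2
        omega
      exact ⟨by omega, h3⟩
  obtain ⟨a, ha⟩ := hw
  exact (key a w ha).1

theorem Horo.D_mem (hconn : T.Connected) (H : Horo T) {o v : V}
    (hv : T.dist o (H.π v) < T.dist o v) :
    ∀ n u, T.dist v u = n → T.dist o u = T.dist o v + n → u ∈ H.D v := by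
  intro n
  induction n with
  | zero =>
    intro u hu _
    exact ⟨0, ((hconn.dist_eq_zero_iff).1 hu).symm⟩
  | succ n ih =>
    intro u hu hou
    obtain ⟨q, hq⟩ := hconn.exists_walk_length_eq_dist u v
    cases q with
    | nil => simp at hu
    | @cons _ b _ hab q =>
      rw [SimpleGraph.Walk.length_cons] at hq
      have h1 := T.dist_le q
      rw [SimpleGraph.dist_comm] at h1 hq
      have h2 := hconn.dist_triangle (u := o) (v := v) (w := b)
      have h3 := hab.diff_dist_adj (u := o)
      have hb := ih b (by omega) (by omega)
      rcases (H.adj _ _).1 hab with h | h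
      · obtain ⟨a, ha⟩ := hb
        exact ⟨a + 1, by rw [Function.iterate_succ_apply, ← h]; exact ha⟩
      · by_cases hbv : b = v
        · exfalso
          rw [h, hbv] at hou
          omega
        · exact H.D_adj hb hbv hab.symm

theorem ball_finite (hconn : T.Connected) (hfin : ∀ v, (T.neighborSet v).Finite) (v : V) (n : ℕ) :
    {w | T.dist v w ≤ n}.Finite := by
  induction n with
  | zero =>
    refine (Set.finite_singleton v).subset ?_
    intro w hw
    rw [Set.mem_ofPred_eq, Nat.le_zero, hconn.dist_eq_zero_iff] at hw
    exact hw.symm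
  | succ n ih =>
    refine ((ih.biUnion (fun b _ => hfin b)).union ih).subset ?_
    intro w hw
    by_cases hwn : T.dist v w ≤ n
    · exact Or.inr hwn
    · left
      obtain ⟨q, hq⟩ := hconn.exists_walk_length_eq_dist w v
      cases q with
      | nil => simp at hwn
      | @cons _ b _ hab q =>
        rw [SimpleGraph.Walk.length_cons] at hq
        have h1 := T.dist_le q
        rw [SimpleGraph.dist_comm] at h1 hq
        rw [Set.mem_ofPred_eq] at hw
        refine Set.mem_biUnion (x := b) ?_ hab.symm
        change T.dist v b ≤ n
        omega

end

section
variable {V A : Type*} {T : SimpleGraph V}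

theorem geo_mid (hconn : T.Connected) {o u : V} {m n : ℕ} (h : T.dist o u = m + n) :
    ∃ v, T.dist o v = m ∧ T.dist v u = n := by
  obtain ⟨p, hp⟩ := hconn.exists_walk_length_eq_dist o u
  refine ⟨p.getVert m, ?_⟩
  have h1 := T.dist_le (p.take m)
  have h2 := T.dist_le (p.drop m)
  have h3 := hconn.dist_triangle (u := o) (v := p.getVert m) (w := u)
  simp only [SimpleGraph.Walk.take_length, SimpleGraph.Walk.drop_length] at h1 h2
  omega

theorem iso_dist_le (hconn : T.Connected) (g : T ≃g T) (a b : V) :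
    T.dist (g a) (g b) ≤ T.dist a b := by
  obtain ⟨p, hp⟩ := hconn.exists_walk_length_eq_dist a b
  rw [← hp]
  have := T.dist_le (p.map g.toHom)
  rw [SimpleGraph.Walk.length_map] at this
  exact this

theorem iso_dist (hconn : T.Connected) (g : T ≃g T) (a b : V) :
    T.dist (g a) (g b) = T.dist a b := by
  apply le_antisymm (iso_dist_le hconn g a b)
  have := iso_dist_le hconn g.symm (g a) (g b)
  simpa using this

theorem main [Finite A] [TopologicalSpace A] [DiscreteTopology A]
    {k : ℕ} (hk : 2 ≤ k) (hconn : T.Connected) (hacyc : T.IsAcyclic)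
    (hreg : ∀ v : V, Nat.card (T.neighborSet v) = k)
    {z : A} {f : (V → A) → (V → A)} (hf : Continuous f)
    (hcomm : ∀ (g : T ≃g T) (x : V → A),
      f (fun t => x (g.symm t)) = fun t => f x (g.symm t))
    (hn : AN f z) : ∃ n : ℕ, ∀ x : V → A, f^[n] x = fun _ => z := by
  classical
  obtain ⟨o⟩ := hconn.nonempty
  have hfinN : ∀ v, (T.neighborSet v).Finite := fun v =>
    Set.finite_coe_iff.1 (Nat.finite_of_card_ne_zero (by rw [hreg]; omega))
  have hball := ball_finite hconn hfinN
  have hnb : ∃ c, T.Adj o c := by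
    have h1 : Nonempty (T.neighborSet o) := by
      by_contra hcon
      rw [not_nonempty_iff] at hcon
      have := hreg o
      rw [Nat.card_of_isEmpty] at this
      omega
    obtain ⟨c, hc⟩ := h1
    exact ⟨c, hc⟩
  obtain ⟨c, hc⟩ := hnb
  obtain ⟨H0, -⟩ := exists_horo hconn hacyc hk hreg o c hc
  have htr : ∀ u v : V, ∃ g : Equiv.Perm V, g u = v ∧ (∀ a b, T.dist (g a) (g b) = T.dist a b) ∧
      ∀ x : V → A, f (fun t => x (g.symm t)) = fun t => f x (g.symm t) := by
    intro u v
    obtain ⟨g, g1, -⟩ := H0.trans u v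
    exact ⟨g.toEquiv, g1, iso_dist hconn g, hcomm g⟩
  obtain ⟨r, hr⟩ := exists_radius (d := T.dist) hf o htr
  obtain ⟨p, -, S, hS, t, hpt⟩ := baire hf hn Set.univ ⟨fun _ => z, trivial⟩
    (Set.finite_singleton o)
  let q : V → A := fun w => if w ∈ S then p w else z
  obtain ⟨R, hR⟩ : ∃ R, ∀ w ∈ S, T.dist o w ≤ R := by
    obtain ⟨R, hR⟩ := (hS.image (fun w => T.dist o w)).bddAbove
    exact ⟨R, fun w hw => hR ⟨w, hw, rfl⟩⟩
  have hNv : ∀ v, ∃ N, T.dist o v = R + 1 → ∀ u, T.dist o u = R + 1 + T.dist v u →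
      r * N < T.dist v u → ∀ s, f^[N + s] q u = z := by
    intro v
    by_cases hv : T.dist o v = R + 1
    · obtain ⟨c, hc1, hc2⟩ := geo_mid hconn hv
      have hadj : T.Adj v c := (SimpleGraph.dist_eq_one_iff_adj.1 hc2).symm
      obtain ⟨H, hH⟩ := exists_horo hconn hacyc hk hreg v c hadj
      have hlt : T.dist o (H.π v) < T.dist o v := by rw [hH]; omega
      obtain ⟨N, hN⟩ := H.level o hf hcomm hn
      refine ⟨N, fun _ u hu hlu s => ?_⟩
      refine H.patch hconn hcomm hr hN (v := v) ?_ ?_ hlu s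
      · intro w hw
        have h1 := H.D_far hconn hacyc hlt hw
        have : w ∉ S := fun hwS => by have := hR w hwS; omega
        exact if_neg this
      · exact H.D_mem hconn hlt _ u rfl (by omega)
    · exact ⟨0, fun h => absurd h hv⟩
  choose Nv hNv using hNv
  obtain ⟨M, hM⟩ : ∃ M, ∀ v, T.dist o v ≤ R + 1 → Nv v ≤ M := by
    obtain ⟨M, hM⟩ := ((hball o (R + 1)).image Nv).bddAbove
    exact ⟨M, fun w hw => hM ⟨w, hw, rfl⟩⟩
  have hfar : ∀ s ≥ M, ∀ u, R + 1 + r * M < T.dist o u → f^[s] q u = z := by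
    intro s hs u hu
    obtain ⟨v, hv1, hv2⟩ := geo_mid hconn
      (show T.dist o u = (R + 1) + (T.dist o u - (R + 1)) by omega)
    have hNM := hM v (by omega)
    have hmul : r * Nv v ≤ r * M := Nat.mul_le_mul_left r hNM
    have := hNv v hv1 u (by omega) (by omega) (s - Nv v)
    rwa [Nat.add_sub_cancel' (by omega)] at this
  obtain ⟨n, hn'⟩ := hn.finite q (hball o (R + 1 + r * M))
  have hmort : f^[n + M] q = fun _ => z := by
    funext u
    by_cases hu : T.dist o u ≤ R + 1 + r * M
    · exact hn' _ (by omega) u hu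
    · exact hfar _ (by omega) u (by omega)
  refine stepC (d := T.dist) (fun a => SimpleGraph.dist_self) (fun a b => SimpleGraph.dist_comm)
    (fun a b c => hconn.dist_triangle) hball hf hr hn ?_ (o := o) (p := q) hS (t := t) ?_ hmort ?_
  · intro u v
    obtain ⟨g, g1, -, g3⟩ := htr u v
    exact ⟨g, g1, g3⟩
  · refine hS.subset ?_
    intro w hw
    by_contra hcon
    exact hw (if_neg hcon)
  · intro x hx m hm
    refine hpt x trivial ?_ m hm o rfl
    intro w hw
    rw [hx w hw]
    exact if_pos hw

end

end TreeCA

/-- Every asymptotically nilpotent cellular automaton on the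
`k`-regular tree (for the full automorphism group action) is nilpotent. -/
theorem tree_CA_asymptotically_nilpotent_implies_nilpotent
    {V A : Type*} [Finite A] [TopologicalSpace A] [DiscreteTopology A]
    (k : ℕ) (hk : 2 ≤ k)
    (T : SimpleGraph V) (hconn : T.Connected) (hacyc : T.IsAcyclic)
    (hreg : ∀ v : V, Nat.card (T.neighborSet v) = k)
    (z : A) (f : (V → A) → (V → A))
    (hf : Continuous f)
    (hcomm : ∀ (g : T ≃g T) (x : V → A),
      f (fun t => x (g.symm t)) = fun t => f x (g.symm t))
    (hnil : ∀ x : V → A,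
      Tendsto (fun n => f^[n] x) atTop (nhds (fun _ => z))) :
    ∃ n : ℕ, ∀ x : V → A, f^[n] x = fun _ => z := by
  refine TreeCA.main hk hconn hacyc hreg hf hcomm ?_
  intro x v
  have h := (tendsto_pi_nhds.1 (hnil x)) v
  rw [nhds_discrete, tendsto_pure, eventually_atTop] at h
  exact h
end

section
/- The group ℤ is nilrigid: for every finite alphabet A with distinguished symbol 0, every continuous map f : A^ℤ → A^ℤ that commutes with the shift σ (where σ(x)_i = x_{i+1}) and satisfies f^n(x) → 0^ℤ for every x ∈ A^ℤ is nilpotent, i.e. there exists n ∈ ℕ with f^n(x) = 0^ℤ for all x ∈ A^ℤ. -/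
open Filter

namespace NilRig

variable {A : Type*} [TopologicalSpace A] [DiscreteTopology A]

theorem cyl_of_nhds (x : ℤ → A) (U : Set (ℤ → A)) (hU : U ∈ nhds x) :
    ∃ k : ℕ, ∀ y : ℤ → A, (∀ i : ℤ, -(k:ℤ) ≤ i → i ≤ k → y i = x i) → y ∈ U := by
  rw [nhds_pi, Filter.mem_pi] at hU
  obtain ⟨I, hI, t, ht, hs⟩ := hU
  refine ⟨hI.toFinset.sup Int.natAbs, fun y hy => hs ?_⟩
  intro i hi
  have h1 : i.natAbs ≤ hI.toFinset.sup Int.natAbs :=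
    Finset.le_sup (f := Int.natAbs) (by simpa using hi)
  rw [hy i (by omega) (by omega)]
  exact mem_of_mem_nhds (ht i)

theorem cyl_mem_nhds (x : ℤ → A) (k : ℕ) :
    {y : ℤ → A | ∀ i : ℤ, -(k:ℤ) ≤ i → i ≤ k → y i = x i} ∈ nhds x := by
  rw [nhds_pi, Filter.mem_pi]
  refine ⟨Set.Icc (-(k:ℤ)) k, Set.finite_Icc _ _, fun i => {x i}, fun i => by simp, ?_⟩
  intro y hy i h1 h2
  simpa using hy i ⟨h1, h2⟩

theorem cyl_open (x : ℤ → A) (k : ℕ) :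
    IsOpen {y : ℤ → A | ∀ i : ℤ, -(k:ℤ) ≤ i → i ≤ k → y i = x i} := by
  rw [isOpen_iff_mem_nhds]
  intro y hy
  filter_upwards [cyl_mem_nhds y k] with w hw i h1 h2
  rw [hw i h1 h2, hy i h1 h2]

theorem shift_iter {f : (ℤ → A) → (ℤ → A)}
    (hcomm : ∀ x : ℤ → A, f (fun i => x (i + 1)) = fun i => f x (i + 1))
    (n : ℕ) (c : ℤ) (x : ℤ → A) :
    f^[n] (fun i => x (i + c)) = fun i => f^[n] x (i + c) := by
  have hnat : ∀ (c : ℕ) (x : ℤ → A), f (fun i => x (i + c)) = fun i => f x (i + c) := by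
    intro c
    induction c with
    | zero => intro x; simp
    | succ c ih =>
      intro x
      have h := ih (fun i => x (i + 1))
      rw [hcomm] at h
      have e1 : (fun i : ℤ => x (i + ((c + 1 : ℕ) : ℤ))) = fun i : ℤ => x (i + c + 1) := by
        funext i; congr 1; push_cast; ring
      rw [e1]
      refine h.trans ?_
      funext i
      congr 1; push_cast; ring
  have hint : ∀ (c : ℤ) (x : ℤ → A), f (fun i => x (i + c)) = fun i => f x (i + c) := by
    intro c x
    rcases Int.eq_nat_or_neg c with ⟨m, rfl | rfl⟩
    · exact hnat m x
    · have h := hnat m (fun i => x (i + -(m:ℤ)))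
      simp only [add_neg_cancel_right, add_assoc, add_neg_cancel, add_zero] at h
      funext i
      have h2 := congrFun h (i + -(m:ℤ))
      simp only [add_assoc, neg_add_cancel, add_zero] at h2
      exact h2.symm
  induction n generalizing x with
  | zero => rfl
  | succ n ih =>
    rw [Function.iterate_succ_apply, hint, ih]
    rfl

theorem loc [Finite A] {f : (ℤ → A) → (ℤ → A)} (hf : Continuous f)
    (hcomm : ∀ x : ℤ → A, f (fun i => x (i + 1)) = fun i => f x (i + 1)) (n : ℕ) :
    ∃ ρ : ℕ, ∀ (x y : ℤ → A) (i : ℤ), (∀ j : ℤ, i - ρ ≤ j → j ≤ i + ρ → x j = y j) →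
      f^[n] x i = f^[n] y i := by
  have hg : Continuous (f^[n]) := hf.iterate n
  let U : ℕ → Set (ℤ → A) := fun k =>
    {x | ∀ y : ℤ → A, (∀ i : ℤ, -(k:ℤ) ≤ i → i ≤ k → y i = x i) → f^[n] y 0 = f^[n] x 0}
  have hUo : ∀ k, IsOpen (U k) := by
    intro k
    rw [isOpen_iff_mem_nhds]
    intro x hx
    filter_upwards [cyl_mem_nhds x k] with w hw y hy
    rw [hx y (fun i h1 h2 => (hy i h1 h2).trans (hw i h1 h2)), hx w hw]
  have hcov : (Set.univ : Set (ℤ → A)) ⊆ ⋃ k, U k := by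
    intro x _
    have : {y : ℤ → A | f^[n] y 0 = f^[n] x 0} ∈ nhds x := by
      have hc : Continuous (fun y => f^[n] y 0) := (continuous_apply 0).comp hg
      have := hc.continuousAt (x := x) (IsOpen.mem_nhds (isOpen_discrete {f^[n] x 0}) rfl)
      exact this
    obtain ⟨k, hk⟩ := cyl_of_nhds x _ this
    exact Set.mem_iUnion.2 ⟨k, hk⟩
  have hmono : Monotone U := by
    intro a b hab x hx y hy
    exact hx y (fun i h1 h2 => hy i (by omega) (by omega))
  obtain ⟨ρ, hρ⟩ := isCompact_univ.elim_directed_cover U hUo hcov hmono.directed_le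
  refine ⟨ρ, fun x y i h => ?_⟩
  have h1 := hρ (Set.mem_univ (fun j => y (j + i))) (fun j => x (j + i))
    (fun j h1 h2 => h _ (by omega) (by omega))
  rw [shift_iter hcomm, shift_iter hcomm] at h1
  simpa using h1

theorem ev_zero {z : A} {f : (ℤ → A) → (ℤ → A)}
    (hnil : ∀ x : ℤ → A, Tendsto (fun n => f^[n] x) atTop (nhds (fun _ => z)))
    (x : ℤ → A) (k : ℕ) :
    ∃ N, ∀ n ≥ N, ∀ i : ℤ, -(k:ℤ) ≤ i → i ≤ k → f^[n] x i = z := by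
  have := (hnil x).eventually (cyl_mem_nhds (fun _ => z) k)
  exact eventually_atTop.1 this

theorem f_zero {z : A} {f : (ℤ → A) → (ℤ → A)}
    (hcomm : ∀ x : ℤ → A, f (fun i => x (i + 1)) = fun i => f x (i + 1))
    (hnil : ∀ x : ℤ → A, Tendsto (fun n => f^[n] x) atTop (nhds (fun _ => z))) (n : ℕ) :
    f^[n] (fun _ => z) = fun _ => z := by
  obtain ⟨N, hN⟩ := ev_zero hnil (fun _ => z) 0
  have h : ∀ m ≥ N, f^[m] (fun _ => z) = fun _ => z := by
    intro m hm
    funext i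
    have h1 := congrFun (shift_iter hcomm m i (fun _ => z)) 0
    have h2 := hN m hm 0 (by simp) (by simp)
    simp only [zero_add] at h1
    rw [← h1, h2]
  calc f^[n] (fun _ => z) = f^[n] (f^[N] (fun _ => z)) := by rw [h N le_rfl]
    _ = f^[n + N] (fun _ => z) := (Function.iterate_add_apply f n N _).symm
    _ = _ := h _ (by omega)

/-- finite mortal configurations -/
def M (z : A) (f : (ℤ → A) → (ℤ → A)) : Set (ℤ → A) :=
  {x | (∃ S : ℕ, ∀ i : ℤ, (i < -(S:ℤ) ∨ (S:ℤ) < i) → x i = z) ∧ ∃ T, f^[T] x = fun _ => z}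

theorem fin_iter [Finite A] {z : A} {f : (ℤ → A) → (ℤ → A)} (hf : Continuous f)
    (hcomm : ∀ x : ℤ → A, f (fun i => x (i + 1)) = fun i => f x (i + 1))
    (n : ℕ) (x w : ℤ → A) (hw : f^[n] w = fun _ => z)
    (h : ∃ S : ℕ, ∀ i : ℤ, (i < -(S:ℤ) ∨ (S:ℤ) < i) → x i = w i) :
    ∃ S : ℕ, ∀ i : ℤ, (i < -(S:ℤ) ∨ (S:ℤ) < i) → f^[n] x i = z := by
  obtain ⟨ρ, hρ⟩ := loc hf hcomm n
  obtain ⟨S, hS⟩ := h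
  refine ⟨S + ρ, fun i hi => ?_⟩
  rw [hρ x w i (fun j h1 h2 => hS j (by push_cast at hi; omega)), hw]

theorem M_iter [Finite A] {z : A} {f : (ℤ → A) → (ℤ → A)} (hf : Continuous f)
    (hcomm : ∀ x : ℤ → A, f (fun i => x (i + 1)) = fun i => f x (i + 1))
    (hnil : ∀ x : ℤ → A, Tendsto (fun n => f^[n] x) atTop (nhds (fun _ => z)))
    (n : ℕ) (x : ℤ → A) (hx : x ∈ M z f) : f^[n] x ∈ M z f := by
  obtain ⟨h1, T, hT⟩ := hx
  refine ⟨fin_iter hf hcomm n x _ (f_zero hcomm hnil n) h1, T, ?_⟩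
  rw [← Function.iterate_add_apply, add_comm, Function.iterate_add_apply, hT,
    f_zero hcomm hnil]

/-- Baire category argument on a closed set. -/
theorem baire [Finite A] {z : A} {f : (ℤ → A) → (ℤ → A)} (hf : Continuous f)
    (hnil : ∀ x : ℤ → A, Tendsto (fun n => f^[n] x) atTop (nhds (fun _ => z)))
    (K : Set (ℤ → A)) (hne : K.Nonempty) (r : ℕ) :
    ∃ p ∈ K, ∃ k N : ℕ, ∀ x ∈ K, (∀ i : ℤ, -(k:ℤ) ≤ i → i ≤ k → x i = p i) →
      ∀ n ≥ N, ∀ i : ℤ, -(r:ℤ) ≤ i → i ≤ r → f^[n] x i = z := by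
  let C : ℕ → Set (ℤ → A) := fun N => {x | ∀ n ≥ N, ∀ i : ℤ, -(r:ℤ) ≤ i → i ≤ r → f^[n] x i = z}
  have hC : ∀ N, IsClosed (C N) := by
    intro N
    have : C N = ⋂ (n : ℕ) (_ : n ≥ N) (i : ℤ) (_ : -(r:ℤ) ≤ i) (_ : i ≤ r),
        {x | f^[n] x i = z} := by
      ext x; simp [C]
    rw [this]
    refine isClosed_iInter fun n => isClosed_iInter fun _ => isClosed_iInter fun i =>
      isClosed_iInter fun _ => isClosed_iInter fun _ => ?_
    exact isClosed_eq ((continuous_apply i).comp (hf.iterate n)) continuous_const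
  haveI : CompactSpace (closure K) := isCompact_iff_compactSpace.1 isClosed_closure.isCompact
  haveI : Nonempty (closure K) := hne.closure.to_subtype
  have hU : (⋃ N, (Subtype.val ⁻¹' (C N) : Set (closure K))) = Set.univ := by
    rw [Set.eq_univ_iff_forall]
    intro x
    obtain ⟨N, hN⟩ := ev_zero hnil x.1 r
    exact Set.mem_iUnion.2 ⟨N, hN⟩
  obtain ⟨N, q, hq⟩ := nonempty_interior_of_iUnion_of_closed
    (fun N => (hC N).preimage continuous_subtype_val) hU
  rw [mem_interior_iff_mem_nhds, nhds_subtype, Filter.mem_comap] at hq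
  obtain ⟨t, ht, hts⟩ := hq
  obtain ⟨k, hk⟩ := cyl_of_nhds _ _ ht
  obtain ⟨p, hp1, hpK⟩ := mem_closure_iff_nhds.1 q.2 _ (cyl_mem_nhds q.1 k)
  refine ⟨p, hpK, k, N, fun x hx hxp => ?_⟩
  have : (⟨x, subset_closure hx⟩ : closure K) ∈ Subtype.val ⁻¹' (C N) :=
    hts (hk x (fun i h1 h2 => (hxp i h1 h2).trans (hp1 i h1 h2)))
  exact this

theorem periodic_wall (p : ℤ → A) (k : ℕ) : ∃ w : ℤ → A, ∃ P : ℕ, 0 < P ∧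
    (∀ q i : ℤ, w (i + q * P) = w i) ∧ ∀ i : ℤ, -(k:ℤ) ≤ i → i ≤ k → w i = p i := by
  refine ⟨fun i => p ((i + k) % (2 * k + 1) - k), 2 * k + 1, by omega, ?_, ?_⟩
  · intro q i
    have : i + q * ((2 * k + 1 : ℕ) : ℤ) + k = (i + k) + q * (2 * k + 1) := by push_cast; ring
    simp only [this, Int.add_mul_emod_self_right]
  · intro i h1 h2
    have : (i + k) % (2 * k + 1) = i + k := Int.emod_eq_of_lt (by omega) (by omega)
    simp only [this]
    congr 1; ring

theorem mortal [Finite A] {z : A} {f : (ℤ → A) → (ℤ → A)} (hf : Continuous f)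
    (hcomm : ∀ x : ℤ → A, f (fun i => x (i + 1)) = fun i => f x (i + 1))
    (hnil : ∀ x : ℤ → A, Tendsto (fun n => f^[n] x) atTop (nhds (fun _ => z))) :
    ∃ w : ℤ → A, ∃ T, f^[T] w = (fun _ => z) ∧
      ∀ x : ℤ → A, ∀ L : ℕ, (∀ i : ℤ, (i < -(L:ℤ) ∨ (L:ℤ) < i) → x i = w i) →
        ∃ T', f^[T'] x = fun _ => z := by
  obtain ⟨R, hR⟩ := loc hf hcomm 1
  obtain ⟨p, -, k, N, hp⟩ := baire hf hnil Set.univ ⟨fun _ => z, trivial⟩ R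
  obtain ⟨w, P, hP, hper, hwp⟩ := periodic_wall p k
  have hper' : ∀ (n : ℕ) (q i : ℤ), f^[n] w (i + q * P) = f^[n] w i := by
    intro n q i
    have h := shift_iter hcomm n (q * P) w
    have e : (fun i => w (i + q * P)) = w := funext fun i => hper q i
    rw [e] at h
    exact (congrFun h i).symm
  obtain ⟨T, hT⟩ := ev_zero hnil w P
  have hwT : ∀ n ≥ T, ∀ i, f^[n] w i = z := by
    intro n hn i
    have hPpos : (0:ℤ) < P := by exact_mod_cast hP
    have e : i = i % P + (i / P) * P := by rw [mul_comm]; exact (Int.emod_add_mul_ediv i P).symm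
    rw [e, hper']
    have := Int.emod_nonneg i hPpos.ne'
    have := Int.emod_lt_of_pos i hPpos
    exact hT n hn _ (by omega) (by omega)
  refine ⟨w, T, funext fun i => hwT T le_rfl i, fun x L hx => ?_⟩
  obtain ⟨ρ, hρ⟩ := loc hf hcomm N
  -- wall positions
  obtain ⟨b, hb1, hbq⟩ : ∃ b : ℕ, L + k + R + ρ + 1 ≤ b ∧ ∃ q : ℕ, b = q * P :=
    ⟨(L + k + R + ρ + 1) * P, Nat.le_mul_of_pos_right _ hP, _, rfl⟩
  obtain ⟨q, hq⟩ := hbq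
  have wall : ∀ (u : ℤ → A) (s : ℤ),
      (∀ i : ℤ, -(k:ℤ) ≤ i → i ≤ k → u (i + s * P) = w (i + s * P)) →
      ∀ n ≥ N, ∀ i : ℤ, s * P - R ≤ i → i ≤ s * P + R → f^[n] u i = z := by
    intro u s hu n hn i h1 h2
    have h := hp (fun i => u (i + s * P)) trivial
      (fun i h1 h2 => by rw [hu i h1 h2, hper, hwp i h1 h2]) n hn (i - s * P)
      (by omega) (by omega)
    rw [shift_iter hcomm] at h
    simpa using h
  have eb : ((q:ℤ)) * P = b := by rw [hq]; push_cast; ring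
  have eb' : (-(q:ℤ)) * P = -b := by rw [hq]; push_cast; ring
  have wxb := wall x q (fun i h1 h2 => hx _ (by rw [eb]; omega))
  have wxa := wall x (-q) (fun i h1 h2 => hx _ (by rw [eb']; omega))
  have wwb := wall w q (fun i h1 h2 => rfl)
  have wwa := wall w (-q) (fun i h1 h2 => rfl)
  rw [eb] at wxb wwb
  rw [eb'] at wxa wwa
  have key : ∀ m : ℕ, ∀ i : ℤ, (i ≤ -(b:ℤ) + R ∨ (b:ℤ) - R ≤ i) →
      f^[N + m] x i = f^[N + m] w i := by
    intro m
    induction m with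
    | zero =>
      intro i hi
      exact hρ x w i (fun j h1 h2 => hx j (by omega))
    | succ m ih =>
      intro i hi
      by_cases c1 : -(b:ℤ) - R ≤ i ∧ i ≤ -(b:ℤ) + R
      · rw [wxa _ (by omega) i c1.1 c1.2, wwa _ (by omega) i c1.1 c1.2]
      by_cases c2 : (b:ℤ) - R ≤ i ∧ i ≤ (b:ℤ) + R
      · rw [wxb _ (by omega) i c2.1 c2.2, wwb _ (by omega) i c2.1 c2.2]
      rw [← add_assoc, Function.iterate_succ_apply', Function.iterate_succ_apply']
      exact hR _ _ i (fun j h1 h2 => ih j (by omega))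
  obtain ⟨T2, hT2⟩ := ev_zero hnil x b
  refine ⟨N + (T + T2), funext fun i => ?_⟩
  by_cases c : i ≤ -(b:ℤ) + R ∨ (b:ℤ) - R ≤ i
  · rw [key _ i c, hwT _ (by omega)]
  · exact hT2 _ (by omega) i (by omega) (by omega)

theorem hit [Finite A] {z : A} {f : (ℤ → A) → (ℤ → A)} (hf : Continuous f)
    (hcomm : ∀ x : ℤ → A, f (fun i => x (i + 1)) = fun i => f x (i + 1))
    (hnil : ∀ x : ℤ → A, Tendsto (fun n => f^[n] x) atTop (nhds (fun _ => z)))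
    (hnon : ∀ n : ℕ, ∃ x : ℤ → A, f^[n] x ≠ fun _ => z) (r m : ℕ) :
    ∃ y ∈ M z f, (∀ i : ℤ, -(r:ℤ) ≤ i → i ≤ r → y i = z) ∧ ∃ n ≥ m, f^[n] y 0 ≠ z := by
  obtain ⟨w, T, hwT, hmort⟩ := mortal hf hcomm hnil
  let U : ℕ → Set (ℤ → A) := fun n =>
    {x | ∃ j ≤ n, ∀ i : ℤ, -(r:ℤ) ≤ i → i ≤ r → f^[j] x i = z}
  have hUo : ∀ n, IsOpen (U n) := by
    intro n
    have : U n = ⋃ (j : ℕ) (_ : j ≤ n), (f^[j]) ⁻¹'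
        {y : ℤ → A | ∀ i : ℤ, -(r:ℤ) ≤ i → i ≤ r → y i = z} := by
      ext x; simp [U]
    rw [this]
    exact isOpen_iUnion fun j => isOpen_iUnion fun _ =>
      (cyl_open (fun _ => z) r).preimage (hf.iterate j)
  have hcov : (Set.univ : Set (ℤ → A)) ⊆ ⋃ k, U k := by
    intro x _
    obtain ⟨N, hN⟩ := ev_zero hnil x r
    exact Set.mem_iUnion.2 ⟨N, N, le_rfl, hN N le_rfl⟩
  have hmono : Monotone U := by
    rintro a b hab x ⟨j, hj, h⟩
    exact ⟨j, hj.trans hab, h⟩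
  obtain ⟨N, hN⟩ := isCompact_univ.elim_directed_cover U hUo hcov hmono.directed_le
  obtain ⟨v0, hv0⟩ := hnon (N + m + T)
  obtain ⟨c, hc⟩ := Function.ne_iff.1 hv0
  obtain ⟨L, hL⟩ := loc hf hcomm (N + m + T)
  let x : ℤ → A := fun i => if -(L:ℤ) ≤ i ∧ i ≤ L then v0 (i + c) else w i
  have hxw : ∀ i : ℤ, (i < -(L:ℤ) ∨ (L:ℤ) < i) → x i = w i := by
    intro i hi
    exact if_neg (by omega)
  have hx0 : f^[N + m + T] x 0 ≠ z := by
    rw [hL x (fun i => v0 (i + c)) 0 (fun j h1 h2 => if_pos (by omega)), shift_iter hcomm]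
    simpa using hc
  obtain ⟨T', hT'⟩ := hmort x L hxw
  have hyM : f^[T] x ∈ M z f := by
    refine ⟨fin_iter hf hcomm T x w hwT ⟨L, hxw⟩, T', ?_⟩
    rw [← Function.iterate_add_apply, add_comm, Function.iterate_add_apply, hT',
      f_zero hcomm hnil]
  obtain ⟨j, hj, hjz⟩ := hN (Set.mem_univ (f^[T] x))
  refine ⟨f^[j] (f^[T] x), M_iter hf hcomm hnil j _ hyM, hjz, N + m - j, by omega, ?_⟩
  rw [← Function.iterate_add_apply, ← Function.iterate_add_apply]
  have : N + m - j + (j + T) = N + m + T := by omega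
  rw [← add_assoc] at this
  rw [this]
  exact hx0

theorem glue [Finite A] {z : A} {f : (ℤ → A) → (ℤ → A)} (hf : Continuous f)
    (hcomm : ∀ x : ℤ → A, f (fun i => x (i + 1)) = fun i => f x (i + 1))
    (hnil : ∀ x : ℤ → A, Tendsto (fun n => f^[n] x) atTop (nhds (fun _ => z)))
    (hnon : ∀ n : ℕ, ∃ x : ℤ → A, f^[n] x ≠ fun _ => z) (y : ℤ → A) (hy : y ∈ M z f) (m : ℕ) :
    ∃ y' ∈ M z f, (∀ i : ℤ, -(m:ℤ) ≤ i → i ≤ m → y' i = y i) ∧ ∃ n ≥ m, f^[n] y' 0 ≠ z := by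
  obtain ⟨⟨S, hS⟩, T, hT⟩ := hy
  obtain ⟨ρ, hρ⟩ := loc hf hcomm T
  obtain ⟨r, hr⟩ : ∃ r : ℕ, r = m + S + 2 * ρ := ⟨_, rfl⟩
  obtain ⟨y2, ⟨⟨S2, hS2⟩, T2, hT2⟩, hy2, n, hn, hn0⟩ := hit hf hcomm hnil hnon r (T + m)
  let y' : ℤ → A := fun i => if -(r:ℤ) ≤ i ∧ i ≤ r then y i else y2 i
  have hin : ∀ i : ℤ, -(r:ℤ) ≤ i → i ≤ r → y' i = y i := fun i h1 h2 => if_pos ⟨h1, h2⟩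
  have hout : ∀ i : ℤ, (i < -(S:ℤ) ∨ (S:ℤ) < i) → y' i = y2 i := by
    intro i hi
    by_cases c : -(r:ℤ) ≤ i ∧ i ≤ r
    · rw [hin i c.1 c.2, hS i hi, hy2 i c.1 c.2]
    · exact if_neg c
  have hT' : f^[T] y' = f^[T] y2 := by
    funext i
    by_cases c : -((S:ℤ) + ρ) ≤ i ∧ i ≤ S + ρ
    · rw [hρ y' y i (fun j h1 h2 => hin j (by omega) (by omega)), hT,
        hρ y2 (fun _ => z) i (fun j h1 h2 => hy2 j (by omega) (by omega)), f_zero hcomm hnil]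
    · exact hρ y' y2 i (fun j h1 h2 => hout j (by omega))
  refine ⟨y', ⟨⟨S + S2, fun i hi => ?_⟩, T2 + T, ?_⟩, fun i h1 h2 => hin i (by omega) (by omega),
    n, by omega, ?_⟩
  · push_cast at hi
    rw [hout i (by omega), hS2 i (by omega)]
  · rw [Function.iterate_add_apply, hT', ← Function.iterate_add_apply, add_comm,
      Function.iterate_add_apply, hT2, f_zero hcomm hnil]
  · have e : n = (n - T) + T := by omega
    rw [e, Function.iterate_add_apply, hT', ← Function.iterate_add_apply, ← e]
    exact hn0

end NilRig

/-- Guillon–Richard. The group `ℤ` is nilrigid: every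
asymptotically nilpotent cellular automaton on `A^ℤ` is nilpotent. -/
theorem int_nilrigid
    {A : Type*} [Finite A] [TopologicalSpace A] [DiscreteTopology A]
    (z : A) (f : (ℤ → A) → (ℤ → A)) (hf : Continuous f)
    (hcomm : ∀ x : ℤ → A, f (fun i => x (i + 1)) = fun i => f x (i + 1))
    (hnil : ∀ x : ℤ → A,
      Tendsto (fun n => f^[n] x) atTop (nhds (fun _ => z))) :
    ∃ n : ℕ, ∀ x : ℤ → A, f^[n] x = fun _ => z := by
  by_contra hcon
  push Not at hcon
  obtain ⟨p, hp, k, N, h⟩ := NilRig.baire hf hnil (NilRig.M z f)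
    ⟨fun _ => z, ⟨0, fun _ _ => rfl⟩, 0, rfl⟩ 0
  obtain ⟨y, hy, hyp, n, hn, hn0⟩ := NilRig.glue hf hcomm hnil hcon p hp (k + N)
  exact hn0 (h y hy (fun i h1 h2 => hyp i (by push_cast; omega) (by push_cast; omega))
    n (by omega) 0 (by simp) (by simp))
end

section
/- Let k ≥ 2, let T be the k-regular tree with vertex set V and graph distance d, and let u, v be adjacent vertices. Let B = {t ∈ V : d(t, u) < d(t, v)} be the vertex set of the component of u in T with the edge {u, v} removed. Then the subgroup H ≤ Aut(T) of automorphisms fixing every vertex of V \ B acts transitively on each sphere {t ∈ B : d(t, u) = n}, for every n ∈ ℕ. -/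
def bsAct {α : Type*} (σ : ℕ → Equiv.Perm α) : List α → List α
  | [] => []
  | a :: l => σ l.length a :: bsAct σ l

theorem bsAct_length {α : Type*} (σ : ℕ → Equiv.Perm α) (l : List α) :
    (bsAct σ l).length = l.length := by
  induction l with
  | nil => rfl
  | cons a l ih => simp [bsAct, ih]

theorem bsAct_congr {α : Type*} (σ τ : ℕ → Equiv.Perm α) (l : List α)
    (h : ∀ i < l.length, σ i = τ i) : bsAct σ l = bsAct τ l := by
  induction l with
  | nil => rfl
  | cons a l ih =>
    simp only [bsAct]
    rw [h l.length (by simp), ih (fun i hi => h i (by simp; omega))]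

theorem bsAct_invol {α : Type*} (σ : ℕ → Equiv.Perm α) (hσ : ∀ i a, σ i (σ i a) = a)
    (l : List α) : bsAct σ (bsAct σ l) = l := by
  induction l with
  | nil => rfl
  | cons a l ih => simp [bsAct, ih, bsAct_length, hσ]

theorem bsAct_exists {α : Type*} (L : List α) : ∀ L' : List α, L.length = L'.length →
    ∃ σ : ℕ → Equiv.Perm α, (∀ i a, σ i (σ i a) = a) ∧ bsAct σ L = L' := by
  classical
  induction L with
  | nil =>
    intro L' h
    refine ⟨fun _ => 1, by simp, ?_⟩
    cases L' with
    | nil => rfl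
    | cons => simp at h
  | cons x M ih =>
    intro L' h
    cases L' with
    | nil => simp at h
    | cons y M' =>
      obtain ⟨σ, h1, h2⟩ := ih M' (by simpa using h)
      refine ⟨Function.update σ M.length (Equiv.swap x y), ?_, ?_⟩
      · intro i a
        by_cases hi : i = M.length
        · subst hi; simp
        · simp [Function.update_of_ne hi, h1]
      · simp only [bsAct, Function.update_self, Equiv.swap_apply_left]
        rw [← h2]
        congr 1
        apply bsAct_congr
        intro i hi
        rw [Function.update_of_ne (by omega)]

section
variable {V : Type*} {T : SimpleGraph V}

theorem bs_closer (hconn : T.Connected) (r w : V) (h : w ≠ r) :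
    ∃ z, T.Adj w z ∧ T.dist w r = T.dist z r + 1 := by
  obtain ⟨p, hp⟩ := hconn.exists_walk_length_eq_dist w r
  cases p with
  | nil => exact absurd rfl h
  | cons hadj q =>
    rename_i z
    refine ⟨z, hadj, ?_⟩
    have h1 := T.dist_le q
    have h2 := hconn.dist_triangle (u := w) (v := z) (w := r)
    rw [SimpleGraph.dist_eq_one_iff_adj.2 hadj] at h2
    simp at hp
    omega

theorem bs_unique (hconn : T.Connected) (hacyc : T.IsAcyclic) (r w x y : V)
    (hx : T.Adj w x) (hy : T.Adj w y) (hdx : T.dist w r = T.dist x r + 1)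
    (hdy : T.dist w r = T.dist y r + 1) : x = y := by
  obtain ⟨p, hp⟩ := hconn.exists_walk_length_eq_dist x r
  obtain ⟨q, hq⟩ := hconn.exists_walk_length_eq_dist y r
  have h1 : (SimpleGraph.Walk.cons hx p).IsPath :=
    SimpleGraph.Walk.isPath_of_length_eq_dist _ (by simp; omega)
  have h2 : (SimpleGraph.Walk.cons hy q).IsPath :=
    SimpleGraph.Walk.isPath_of_length_eq_dist _ (by simp; omega)
  have h3 := hacyc.path_unique ⟨_, h1⟩ ⟨_, h2⟩
  have h4 := congrArg (fun p : T.Path w r => p.1.snd) h3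
  simpa using h4

theorem bs_child (hconn : T.Connected) (hacyc : T.IsAcyclic) (k : ℕ) (hk : 2 ≤ k)
    (hreg : ∀ v : V, Nat.card (T.neighborSet v) = k) (v x : V) :
    ∃ f : Fin (k - 1) → V, x ≠ v → Function.Injective f ∧
      ∀ y, (∃ a, f a = y) ↔ (T.Adj x y ∧ T.dist y v = T.dist x v + 1) := by
  classical
  by_cases hx : x = v
  · exact ⟨fun _ => v, fun h => absurd hx h⟩
  obtain ⟨z, hz, hzd⟩ := bs_closer hconn v x hx
  set C : Set V := {y | T.Adj x y ∧ T.dist y v = T.dist x v + 1} with hC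
  have hN : T.neighborSet x = insert z C := by
    ext y
    simp only [SimpleGraph.mem_neighborSet, Set.mem_insert_iff, hC, Set.mem_setOf_eq]
    constructor
    · intro hy
      rcases (SimpleGraph.IsTree.mk hconn hacyc).dist_eq_dist_add_one_of_adj v hy with h | h
      · left
        rw [SimpleGraph.dist_comm, T.dist_comm (u := v)] at h
        exact bs_unique hconn hacyc v x y z hy hz h hzd
      · right
        rw [SimpleGraph.dist_comm, T.dist_comm (u := v)] at h
        exact ⟨hy, h⟩
    · rintro (rfl | h)
      · exact hz
      · exact h.1
  have hzC : z ∉ C := by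
    intro h
    have := h.2
    omega
  have hfin : (T.neighborSet x).Finite := by
    apply Set.finite_of_ncard_ne_zero
    rw [← Nat.card_coe_set_eq, hreg]; omega
  have hCfin : C.Finite := hfin.subset (by rw [hN]; exact Set.subset_insert _ _)
  have hcard : Nat.card C = k - 1 := by
    have h1 := hreg x
    rw [Nat.card_coe_set_eq, hN, Set.ncard_insert_of_notMem hzC hCfin] at h1
    rw [Nat.card_coe_set_eq]; omega
  have : Finite C := hCfin
  let e : Fin (k - 1) ≃ C := (Finite.equivFinOfCardEq hcard).symm
  refine ⟨fun a => (e a : V), fun _ => ⟨fun a b h => e.injective (Subtype.ext h), fun y => ?_⟩⟩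
  constructor
  · rintro ⟨a, rfl⟩
    exact (e a).2
  · intro h
    exact ⟨e.symm ⟨y, h⟩, by simp⟩

def bsPhi {m : ℕ} (u : V) (f : V → Fin m → V) : List (Fin m) → V
  | [] => u
  | a :: l => f (bsPhi u f l) a

end


/-- In the `k`-regular tree, for adjacent vertices `u, v`,
the group of automorphisms fixing pointwise the complement of the component
`B` of `u` (in the tree minus the edge `{u, v}`) acts transitively on each
sphere `{t ∈ B : d(t, u) = n}`. -/
theorem branch_stabilizer_transitive_on_spheres
    {V : Type*} (k : ℕ) (hk : 2 ≤ k)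
    (T : SimpleGraph V) (hconn : T.Connected) (hacyc : T.IsAcyclic)
    (hreg : ∀ v : V, Nat.card (T.neighborSet v) = k)
    (u v : V) (huv : T.Adj u v)
    (B : Set V) (hB : B = {t : V | T.dist t u < T.dist t v})
    (n : ℕ) (t t' : V) (ht : t ∈ B) (ht' : t' ∈ B)
    (hd : T.dist t u = n) (hd' : T.dist t' u = n) :
    ∃ g : T ≃g T, (∀ w ∉ B, g w = w) ∧ g t = t' := by
  classical
  have hT : T.IsTree := ⟨hconn, hacyc⟩
  have hB' : ∀ w, w ∈ B ↔ T.dist w v = T.dist w u + 1 := by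
    intro w
    have := hT.dist_eq_dist_add_one_of_adj w huv
    rw [hB, Set.mem_setOf_eq]; omega
  have hBn : ∀ w, w ∉ B → T.dist w u = T.dist w v + 1 := by
    intro w
    have := hT.dist_eq_dist_add_one_of_adj w huv
    rw [hB, Set.mem_setOf_eq]; omega
  clear hB
  have hadjd : ∀ r x y, T.Adj x y → T.dist x r = T.dist y r + 1 ∨ T.dist y r = T.dist x r + 1 := by
    intro r x y h
    have := hT.dist_eq_dist_add_one_of_adj r h
    rwa [SimpleGraph.dist_comm, T.dist_comm (u := r)] at this
  have huB : u ∈ B := by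
    rw [hB', SimpleGraph.dist_eq_one_iff_adj.2 huv]; simp
  have hBv : ∀ x ∈ B, x ≠ v := by
    rintro x hx rfl
    have := (hB' _).1 hx
    simp at this
  -- parents
  have hpar : ∀ w ∈ B, w ≠ u → ∃ z ∈ B, T.Adj z w ∧ T.dist w v = T.dist z v + 1 ∧
      T.dist w u = T.dist z u + 1 := by
    intro w hw hwu
    obtain ⟨z, hz, hzd⟩ := bs_closer hconn u w hwu
    have h1 := hadjd v _ _ hz
    have h2 := (hB' w).1 hw
    have h3 := hT.dist_eq_dist_add_one_of_adj z huv
    refine ⟨z, ?_, hz.symm, ?_, hzd⟩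
    · rw [hB']; omega
    · omega
  choose f hf using bs_child hconn hacyc k hk hreg v
  set φ := bsPhi u f with hφ
  have hφ0 : φ [] = u := rfl
  have hφc : ∀ a l, φ (a :: l) = f (φ l) a := fun _ _ => rfl
  have hφB : ∀ l, φ l ∈ B ∧ T.dist (φ l) v = l.length + 1 := by
    intro l
    induction l with
    | nil => exact ⟨huB, by rw [hφ0, SimpleGraph.dist_eq_one_iff_adj.2 huv]; rfl⟩
    | cons a l ih =>
      have h1 := ((hf (φ l) (hBv _ ih.1)).2 (φ (a :: l))).1 ⟨a, rfl⟩
      have h2 := hadjd u _ _ h1.1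
      have h3 := (hB' _).1 ih.1
      have h4 := hT.dist_eq_dist_add_one_of_adj (φ (a :: l)) huv
      refine ⟨?_, ?_⟩
      · rw [hB']; omega
      · rw [h1.2, ih.2]; simp
  have hchild : ∀ a l, T.Adj (φ l) (φ (a :: l)) ∧
      T.dist (φ (a :: l)) v = T.dist (φ l) v + 1 := fun a l =>
    ((hf (φ l) (hBv _ (hφB l).1)).2 (φ (a :: l))).1 ⟨a, rfl⟩
  have hinj : Function.Injective φ := by
    intro l
    induction l with
    | nil =>
      intro l' h
      have h1 := (hφB []).2
      rw [h, (hφB l').2] at h1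
      cases l' with
      | nil => rfl
      | cons => simp at h1
    | cons a l ih =>
      intro l' h
      cases l' with
      | nil =>
        have h1 := (hφB []).2
        rw [← h, (hφB _).2] at h1
        simp at h1
      | cons b l' =>
        have c1 := hchild a l
        have c2 := hchild b l'
        rw [← h] at c2
        have h3 : φ l = φ l' := bs_unique hconn hacyc v _ _ _ c1.1.symm c2.1.symm c1.2 c2.2
        have h4 := ih h3
        subst h4
        have h5 : f (φ l) a = f (φ l) b := h
        rw [(hf (φ l) (hBv _ (hφB l).1)).1 h5]
  have hsurj : ∀ m, ∀ w ∈ B, T.dist w u = m → ∃ l, φ l = w := by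
    intro m
    induction m with
    | zero =>
      intro w _ h
      exact ⟨[], ((hconn.dist_eq_zero_iff).1 h).symm⟩
    | succ m ih =>
      intro w hw h
      have hwu : w ≠ u := by rintro rfl; simp at h
      obtain ⟨z, hzB, hz, hzv, hzu⟩ := hpar w hw hwu
      obtain ⟨l, rfl⟩ := ih z hzB (by omega)
      obtain ⟨a, ha⟩ := ((hf (φ l) (hBv _ hzB)).2 w).2 ⟨hz, hzv⟩
      exact ⟨a :: l, ha⟩
  obtain ⟨L, hL⟩ := hsurj n t ht hd
  obtain ⟨L', hL'⟩ := hsurj n t' ht' hd'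
  have hlen : L.length = L'.length := by
    have h1 := (hφB L).2
    have h2 := (hφB L').2
    rw [hL, (hB' _).1 ht] at h1
    rw [hL', (hB' _).1 ht'] at h2
    omega
  obtain ⟨σ, hσ, hσL⟩ := bsAct_exists L L' hlen
  obtain ⟨ψ, hψ⟩ := hinj.hasLeftInverse
  let g : V → V := fun w => if w ∈ B then φ (bsAct σ (ψ w)) else w
  have hgn : ∀ w ∉ B, g w = w := fun w hw => if_neg hw
  have hgφ : ∀ l, g (φ l) = φ (bsAct σ l) := by
    intro l
    simp only [g]
    rw [if_pos (hφB l).1, hψ l]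
  have hgg : ∀ w, g (g w) = w := by
    intro w
    by_cases hw : w ∈ B
    · obtain ⟨l, rfl⟩ := hsurj _ w hw rfl
      rw [hgφ, hgφ, bsAct_invol σ hσ]
    · rw [hgn w hw, hgn w hw]
  have hgu : g u = u := by
    rw [← hφ0, hgφ]; rfl
  have hcross : ∀ x y, x ∈ B → y ∉ B → T.Adj x y → x = u := by
    intro x y hx hy hxy
    by_contra hxu
    obtain ⟨z, hzB, hz, hzv, hzu⟩ := hpar x hx hxu
    have h1 := (hB' x).1 hx
    have h2 := hBn y hy
    have h3 := hadjd v _ _ hxy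
    have h4 := hadjd u _ _ hxy
    have : y = z := bs_unique hconn hacyc v x y z hxy hz.symm (by omega) hzv
    exact hy (this ▸ hzB)
  have hdown : ∀ l y, T.Adj (φ l) y → T.dist y v = T.dist (φ l) v + 1 →
      T.Adj (g (φ l)) (g y) := by
    intro l y h1 h2
    obtain ⟨a, ha⟩ := ((hf (φ l) (hBv _ (hφB l).1)).2 y).2 ⟨h1, h2⟩
    rw [← hφc] at ha
    rw [← ha, hgφ, hgφ]
    exact (hchild _ _).1
  have hgadj : ∀ x y, T.Adj x y → T.Adj (g x) (g y) := by
    intro x y hxy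
    by_cases hx : x ∈ B
    · by_cases hy : y ∈ B
      · obtain ⟨l, rfl⟩ := hsurj _ x hx rfl
        obtain ⟨l', rfl⟩ := hsurj _ y hy rfl
        rcases hadjd v _ _ hxy with h | h
        · exact (hdown l' _ hxy.symm h).symm
        · exact hdown l _ hxy h
      · have := hcross x y hx hy hxy
        subst this
        rw [hgu, hgn y hy]; exact hxy
    · by_cases hy : y ∈ B
      · have := hcross y x hy hx hxy.symm
        subst this
        rw [hgu, hgn x hx]; exact hxy
      · rw [hgn x hx, hgn y hy]; exact hxy
  refine ⟨⟨⟨g, g, hgg, hgg⟩, ?_⟩, hgn, ?_⟩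
  · intro x y
    refine ⟨fun h => ?_, hgadj x y⟩
    have := hgadj _ _ h
    simpa [hgg] using this
  · change g t = t'
    rw [← hL, hgφ, hσL, hL']
end
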